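/- arXiv:0902.1414 — 6 statements merged into one kernel-verified Lean document; each statement's English description precedes it below -/
import Mathlib

section
/- Let a < b be real numbers and let f : (a,b) → ℝ be continuous. Suppose that for every t ∈ (a,b) and every δ > 0 there exists d with 0 < d < δ such that t−d ∈ (a,b), t+d ∈ (a,b), and Δ²f(t+d, t−d) ≤ 0, i.e. (f(t+d)+f(t−d))/2 ≤ f(t). Then f is concave on (a,b). -/
open Set

/-- A minimum principle: a continuous function satisfying the midpoint condition at arbitrarily
small scales is nonnegative on an interval if it is nonnegative at both endpoints. -/
theorem nonneg_of_midpoint_condition {x y : ℝ} {g : ℝ → ℝ} (hg : ContinuousOn g (Icc x y))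
    (H : ∀ t ∈ Ioo x y, ∀ δ > (0 : ℝ), ∃ d : ℝ, 0 < d ∧ d < δ ∧
      (g (t + d) + g (t - d)) / 2 ≤ g t)
    (hx : 0 ≤ g x) (hy : 0 ≤ g y) {z : ℝ} (hz : z ∈ Icc x y) : 0 ≤ g z := by
  obtain ⟨m, hm, hmin⟩ := isCompact_Icc.exists_isMinOn ⟨z, hz⟩ hg
  rw [isMinOn_iff] at hmin
  by_contra! hneg
  have hm_neg : g m < 0 := (hmin z hz).trans_lt hneg
  have hcompact : IsCompact (Icc x y ∩ g ⁻¹' Iic (g m)) :=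
    isCompact_Icc.of_isClosed_subset
      (hg.preimage_isClosed_of_isClosed isClosed_Icc isClosed_Iic) inter_subset_left
  obtain ⟨t, ⟨ht, htm⟩, hleast⟩ := hcompact.exists_isLeast ⟨m, hm, le_refl (g m)⟩
  rw [mem_preimage, mem_Iic] at htm
  have hxt : x < t := lt_of_le_of_ne ht.1 (by rintro rfl; linarith)
  have hty : t < y := lt_of_le_of_ne ht.2 (by rintro rfl; linarith)
  obtain ⟨d, hd, hdδ, hmid⟩ := H t ⟨hxt, hty⟩ (min (t - x) (y - t))
    (lt_min (sub_pos.2 hxt) (sub_pos.2 hty))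
  obtain ⟨hdx, hdy⟩ := lt_min_iff.1 hdδ
  have hleft : g m < g (t - d) := by
    by_contra! hle
    have := hleast ⟨⟨by linarith, by linarith⟩, hle⟩
    linarith
  have hright : g m ≤ g (t + d) := hmin _ ⟨by linarith, by linarith⟩
  linarith

/-- Let `a < b` and let `f` be continuous on `(a,b)`. If for every
`t ∈ (a,b)` and every `δ > 0` there is `0 < d < δ` with `t ± d ∈ (a,b)` and
`(f (t+d) + f (t-d))/2 ≤ f t` (i.e. `Δ²f(t+d, t−d) ≤ 0`), then `f` is concave on `(a,b)`. -/
theorem concaveOn_of_midpoint_condition_Ioo (a b : ℝ) (hab : a < b) (f : ℝ → ℝ)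
    (hf : ContinuousOn f (Ioo a b))
    (H : ∀ t ∈ Ioo a b, ∀ δ > (0:ℝ), ∃ d : ℝ, 0 < d ∧ d < δ ∧
      t - d ∈ Ioo a b ∧ t + d ∈ Ioo a b ∧ (f (t + d) + f (t - d)) / 2 ≤ f t) :
    ConcaveOn ℝ (Ioo a b) f := by
  refine LinearOrder.concaveOn_of_lt (convex_Ioo a b) ?_
  intro x hx y hy hxy α β hα hβ hαβ
  have hsub : Icc x y ⊆ Ioo a b := fun t ht => ⟨hx.1.trans_le ht.1, ht.2.trans_lt hy.2⟩
  set p : ℝ := (f y - f x) / (y - x)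
  have hslope : p * (y - x) = f y - f x := div_mul_cancel₀ _ (sub_pos.2 hxy).ne'
  have hz : α * x + β * y ∈ Icc x y := by
    obtain rfl : α = 1 - β := by linarith
    constructor <;> nlinarith
  have hnonneg := nonneg_of_midpoint_condition (g := fun t => f t - (f x + p * (t - x)))
    ((hf.mono hsub).sub (by fun_prop))
    (fun t ht δ hδ => by
      obtain ⟨d, hd, hdδ, -, -, hmid⟩ := H t (hsub (Ioo_subset_Icc_self ht)) δ hδ
      exact ⟨d, hd, hdδ, by linarith⟩)
    (by simp) (by linarith) hz
  simp only [smul_eq_mul]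
  obtain rfl : α = 1 - β := by linarith
  have hchord : p * ((1 - β) * x + β * y - x) = β * (f y - f x) := by
    rw [← hslope]; ring
  linarith
end

section
/- Let Y be a geodesic metric space, M ⊆ Y open, c ≥ 0, and f : M → ℝ locally Lipschitz. Then the following are equivalent: (i) f is c-concave on M; (ii) whenever x, y ∈ M and s = γ((a+b)/2) for some minimal curve γ : [a,b] → Y with γ(a) = x, γ(b) = y and range contained in M, one has (f(x)+f(y))/2 − f(s) ≤ (c/2)·(dist(x,y)/2)². -/
open Set Metric
open scoped NNReal

/-- A minimal curve on `[a,b]`: an arclength-parametrized shortest path. -/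
def IsMinimalCurve {Y : Type*} [MetricSpace Y] (γ : ℝ → Y) (a b : ℝ) : Prop :=
  ∀ s ∈ Icc a b, ∀ t ∈ Icc a b, dist (γ s) (γ t) = |s - t|

/-- A geodesic space: any two points are joined by a minimal curve. -/
def IsGeodesicSpace (Y : Type*) [MetricSpace Y] : Prop :=
  ∀ x y : Y, ∃ γ : ℝ → Y, IsMinimalCurve γ 0 (dist x y) ∧ γ 0 = x ∧ γ (dist x y) = y

/-- `f` is `c`-concave on `M`: for each minimal curve `γ : [a,b] → Y` with range in `M`,
`t ↦ f (γ t) - (c/2) t²` is concave on `[a,b]`. -/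
def CConcaveOn {Y : Type*} [MetricSpace Y] (c : ℝ) (M : Set Y) (f : Y → ℝ) : Prop :=
  ∀ (a b : ℝ) (γ : ℝ → Y), a ≤ b → IsMinimalCurve γ a b → MapsTo γ (Icc a b) M →
    ConcaveOn ℝ (Icc a b) (fun t => f (γ t) - c / 2 * t ^ 2)

/-- `f` is locally Lipschitz on `s`. -/
def LocallyLipschitzOnSet {Y : Type*} [MetricSpace Y] (s : Set Y) (f : Y → ℝ) : Prop :=
  ∀ x ∈ s, ∃ ε > (0:ℝ), ∃ K : ℝ≥0, LipschitzOnWith K f (ball x ε ∩ s)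

/-- A continuous midpoint-concave function on `[p,q]` that is nonnegative at both endpoints is
nonnegative on `[p,q]`. -/
theorem nonneg_of_midpoint_le {p q : ℝ} {h : ℝ → ℝ} (hc : ContinuousOn h (Icc p q))
    (hmid : ∀ s ∈ Icc p q, ∀ t ∈ Icc p q, s < t → (h s + h t) / 2 ≤ h ((s + t) / 2))
    (hp : 0 ≤ h p) (hq : 0 ≤ h q) {t : ℝ} (ht : t ∈ Icc p q) : 0 ≤ h t := by
  obtain ⟨m, hm, hmin⟩ := isCompact_Icc.exists_isMinOn ⟨t, ht⟩ hc
  rw [isMinOn_iff] at hmin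
  by_contra! hneg
  have hm0 : h m < 0 := (hmin t ht).trans_lt hneg
  have hcl : IsCompact (Icc p q ∩ h ⁻¹' Iic (h m)) :=
    isCompact_Icc.of_isClosed_subset (hc.preimage_isClosed_of_isClosed isClosed_Icc isClosed_Iic)
      inter_subset_left
  obtain ⟨u, ⟨hu, hum⟩, hleast⟩ := hcl.exists_isLeast ⟨m, hm, le_refl (h m)⟩
  simp only [mem_preimage, mem_Iic] at hum
  have hpu : p < u := lt_of_le_of_ne hu.1 (by rintro rfl; linarith)
  have huq : u < q := lt_of_le_of_ne hu.2 (by rintro rfl; linarith)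
  obtain ⟨δ, hδ, hδp, hδq⟩ : ∃ δ > 0, p ≤ u - δ ∧ u + δ ≤ q :=
    ⟨min (u - p) (q - u), lt_min (by linarith) (by linarith),
      by linarith [min_le_left (u - p) (q - u)], by linarith [min_le_right (u - p) (q - u)]⟩
  have hl : u - δ ∈ Icc p q := ⟨hδp, by linarith⟩
  have hr : u + δ ∈ Icc p q := ⟨by linarith, hδq⟩
  have hlt : h m < h (u - δ) := by
    by_contra! hle
    linarith [hleast ⟨hl, hle⟩]
  have hmid' := hmid _ hl _ hr (by linarith)
  rw [show (u - δ + (u + δ)) / 2 = u by ring] at hmid'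
  linarith [hmin _ hr]

/-- A continuous midpoint-concave function on `[a,b]` is concave. -/
theorem concaveOn_Icc_of_midpoint_le {a b : ℝ} {g : ℝ → ℝ} (hc : ContinuousOn g (Icc a b))
    (hmid : ∀ s ∈ Icc a b, ∀ t ∈ Icc a b, s < t → (g s + g t) / 2 ≤ g ((s + t) / 2)) :
    ConcaveOn ℝ (Icc a b) g := by
  refine LinearOrder.concaveOn_of_lt (convex_Icc a b) fun x hx y hy hxy α β hα hβ hαβ => ?_
  have hsub : Icc x y ⊆ Icc a b := Icc_subset_Icc hx.1 hy.2
  obtain ⟨k, hkxy⟩ : ∃ k, k * (y - x) = g y - g x :=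
    ⟨(g y - g x) / (y - x), div_mul_cancel₀ _ (by linarith)⟩
  have hz : α * x + β * y ∈ Icc x y := by
    obtain rfl : α = 1 - β := by linarith
    constructor <;> nlinarith
  have key := nonneg_of_midpoint_le (h := fun t => g t - (g x + k * (t - x)))
    ((hc.mono hsub).sub (by fun_prop))
    (fun s hs t ht hst => by
      have := hmid s (hsub hs) t (hsub ht) hst
      linarith)
    (by simp) (by simp [hkxy]) hz
  obtain rfl : α = 1 - β := by linarith
  simp only [smul_eq_mul]
  linear_combination key - β * hkxy

theorem IsMinimalCurve.mono {Y : Type*} [MetricSpace Y] {γ : ℝ → Y} {a b s t : ℝ}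
    (hγ : IsMinimalCurve γ a b) (hs : a ≤ s) (ht : t ≤ b) : IsMinimalCurve γ s t :=
  fun _ hu _ hv => hγ _ (Icc_subset_Icc hs ht hu) _ (Icc_subset_Icc hs ht hv)

theorem IsMinimalCurve.continuousOn {Y : Type*} [MetricSpace Y] {γ : ℝ → Y} {a b : ℝ}
    (hγ : IsMinimalCurve γ a b) : ContinuousOn γ (Icc a b) := by
  have : LipschitzOnWith 1 γ (Icc a b) := LipschitzOnWith.of_dist_le_mul fun s hs t ht => by
    simp [hγ s hs t ht, Real.dist_eq]
  exact this.continuousOn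

theorem LocallyLipschitzOnSet.continuousOn {Y : Type*} [MetricSpace Y] {s : Set Y} {f : Y → ℝ}
    (hf : LocallyLipschitzOnSet s f) : ContinuousOn f s := by
  intro x hx
  obtain ⟨ε, hε, K, hK⟩ := hf x hx
  have := hK.continuousOn x ⟨mem_ball_self hε, hx⟩
  rwa [inter_comm, continuousWithinAt_inter (ball_mem_nhds x hε)] at this

/-- Let `Y` be a geodesic space, `M ⊆ Y` open, `c ≥ 0`, and `f` locally
Lipschitz on `M`. Then `f` is `c`-concave on `M` iff for every minimal curve `γ : [a,b] → Y`
with range in `M` joining `x = γ a` and `y = γ b`, the midpoint `s = γ ((a+b)/2)` satisfies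
`(f x + f y)/2 - f s ≤ (c/2) (dist x y / 2)²`. -/
theorem cConcaveOn_iff_midpoint {Y : Type*} [MetricSpace Y] (hY : IsGeodesicSpace Y)
    (M : Set Y) (hM : IsOpen M) (c : ℝ) (hc : 0 ≤ c) (f : Y → ℝ)
    (hf : LocallyLipschitzOnSet M f) :
    CConcaveOn c M f ↔
      ∀ (a b : ℝ) (γ : ℝ → Y) (x y s : Y), a ≤ b → IsMinimalCurve γ a b →
        MapsTo γ (Icc a b) M → γ a = x → γ b = y → γ ((a + b) / 2) = s →
        (f x + f y) / 2 - f s ≤ c / 2 * (dist x y / 2) ^ 2 := by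
  constructor
  · rintro h a b γ x y s hab hγ hM rfl rfl rfl
    have ha : a ∈ Icc a b := left_mem_Icc.2 hab
    have hb : b ∈ Icc a b := right_mem_Icc.2 hab
    have key := (h a b γ hab hγ hM).2 ha hb (show (0 : ℝ) ≤ 1 / 2 by norm_num)
      (show (0 : ℝ) ≤ 1 / 2 by norm_num) (by norm_num)
    simp only [smul_eq_mul] at key
    rw [show 1 / 2 * a + 1 / 2 * b = (a + b) / 2 by ring] at key
    rw [hγ a ha b hb, div_pow, sq_abs]
    linear_combination key
  · intro h a b γ hab hγ hM
    refine concaveOn_Icc_of_midpoint_le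
      ((hf.continuousOn.comp hγ.continuousOn hM).sub (by fun_prop)) fun s hs t ht hst => ?_
    have key := h s t γ _ _ _ hst.le (hγ.mono hs.1 ht.2)
      (hM.mono_left (Icc_subset_Icc hs.1 ht.2)) rfl rfl rfl
    rw [hγ s hs t ht, div_pow, sq_abs] at key
    linear_combination key
end

section
/- Let U ⊆ ℝⁿ and V ⊆ ℝ^m be open sets, let F : U → ℝ^m be locally DC with F(U) ⊆ V, and let G : V → ℝ^k be locally DC. Then the composition G ∘ F is locally DC on U. -/
open Set

/-- `f` is DC on the convex set `C`: a difference of two continuous convex functions on `C`. -/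
def IsDCOn {E : Type*} [NormedAddCommGroup E] [NormedSpace ℝ E]
    (C : Set E) (f : E → ℝ) : Prop :=
  ∃ g h : E → ℝ, ConvexOn ℝ C g ∧ ConvexOn ℝ C h ∧
    ContinuousOn g C ∧ ContinuousOn h C ∧ ∀ x ∈ C, f x = g x - h x

/-- A mapping `F : C → F'` is DC if `ℓ ∘ F` is DC for every linear functional `ℓ`. -/
def IsDCMapOn {E F' : Type*} [NormedAddCommGroup E] [NormedSpace ℝ E]
    [NormedAddCommGroup F'] [NormedSpace ℝ F'] (C : Set E) (F : E → F') : Prop :=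
  ∀ ℓ : F' →ₗ[ℝ] ℝ, IsDCOn C (fun x => ℓ (F x))

/-- `F` is locally DC on the open set `U`: every point of `U` has an open convex
neighborhood contained in `U` on which `F` is DC. -/
def LocallyDCMapOn {E F' : Type*} [NormedAddCommGroup E] [NormedSpace ℝ E]
    [NormedAddCommGroup F'] [NormedSpace ℝ F'] (U : Set E) (F : E → F') : Prop :=
  ∀ x ∈ U, ∃ V : Set E, IsOpen V ∧ Convex ℝ V ∧ x ∈ V ∧ V ⊆ U ∧ IsDCMapOn V F

theorem IsDCOn.mono {E : Type*} [NormedAddCommGroup E] [NormedSpace ℝ E] {C D : Set E}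
    {f : E → ℝ} (hf : IsDCOn C f) (hD : Convex ℝ D) (hDC : D ⊆ C) : IsDCOn D f := by
  obtain ⟨g, h, hg, hh, hgc, hhc, hfgh⟩ := hf
  exact ⟨g, h, hg.subset hDC hD, hh.subset hDC hD, hgc.mono hDC, hhc.mono hDC,
    fun x hx => hfgh x (hDC hx)⟩

theorem IsDCOn.congr {E : Type*} [NormedAddCommGroup E] [NormedSpace ℝ E] {C : Set E}
    {f f' : E → ℝ} (hf : IsDCOn C f) (hff' : ∀ x ∈ C, f' x = f x) : IsDCOn C f' := by
  obtain ⟨g, h, hg, hh, hgc, hhc, hfgh⟩ := hf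
  exact ⟨g, h, hg, hh, hgc, hhc, fun x hx => (hff' x hx).trans (hfgh x hx)⟩

theorem IsDCOn.continuousOn {E : Type*} [NormedAddCommGroup E] [NormedSpace ℝ E] {C : Set E}
    {f : E → ℝ} (hf : IsDCOn C f) : ContinuousOn f C := by
  obtain ⟨g, h, -, -, hgc, hhc, hfgh⟩ := hf
  exact (hgc.sub hhc).congr hfgh

theorem isDCOn_zero {E : Type*} [NormedAddCommGroup E] [NormedSpace ℝ E] {C : Set E}
    (hC : Convex ℝ C) : IsDCOn C fun _ => (0 : ℝ) :=
  ⟨fun _ => 0, fun _ => 0, convexOn_const 0 hC, convexOn_const 0 hC, continuousOn_const,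
    continuousOn_const, fun _ _ => by simp⟩

theorem IsDCOn.add {E : Type*} [NormedAddCommGroup E] [NormedSpace ℝ E] {C : Set E}
    {f f' : E → ℝ} (hf : IsDCOn C f) (hf' : IsDCOn C f') : IsDCOn C fun x => f x + f' x := by
  obtain ⟨g, h, hg, hh, hgc, hhc, hfgh⟩ := hf
  obtain ⟨g', h', hg', hh', hgc', hhc', hfgh'⟩ := hf'
  refine ⟨g + g', h + h', hg.add hg', hh.add hh', hgc.add hgc', hhc.add hhc', fun x hx => ?_⟩
  simp only [Pi.add_apply, hfgh x hx, hfgh' x hx]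
  ring

theorem IsDCOn.neg {E : Type*} [NormedAddCommGroup E] [NormedSpace ℝ E] {C : Set E}
    {f : E → ℝ} (hf : IsDCOn C f) : IsDCOn C fun x => -f x := by
  obtain ⟨g, h, hg, hh, hgc, hhc, hfgh⟩ := hf
  exact ⟨h, g, hh, hg, hhc, hgc, fun x hx => by simp [hfgh x hx]⟩

theorem IsDCOn.sub {E : Type*} [NormedAddCommGroup E] [NormedSpace ℝ E] {C : Set E}
    {f f' : E → ℝ} (hf : IsDCOn C f) (hf' : IsDCOn C f') : IsDCOn C fun x => f x - f' x := by
  simpa only [sub_eq_add_neg] using hf.add hf'.neg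

theorem IsDCOn.const_mul {E : Type*} [NormedAddCommGroup E] [NormedSpace ℝ E] {C : Set E}
    {f : E → ℝ} (hf : IsDCOn C f) (r : ℝ) : IsDCOn C fun x => r * f x := by
  wlog hr : 0 ≤ r generalizing r
  · simpa using (this (-r) (by linarith)).neg
  obtain ⟨g, h, hg, hh, hgc, hhc, hfgh⟩ := hf
  exact ⟨fun x => r * g x, fun x => r * h x, hg.smul hr, hh.smul hr, continuousOn_const.mul hgc,
    continuousOn_const.mul hhc, fun x hx => by simp [hfgh x hx, mul_sub]⟩

theorem IsDCOn.sum {E ι : Type*} [NormedAddCommGroup E] [NormedSpace ℝ E] {C : Set E}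
    (hC : Convex ℝ C) (s : Finset ι) {f : ι → E → ℝ} (hf : ∀ i ∈ s, IsDCOn C (f i)) :
    IsDCOn C fun x => ∑ i ∈ s, f i x := by
  induction s using Finset.cons_induction with
  | empty => simpa using isDCOn_zero hC
  | cons a s ha ih =>
    simp only [Finset.sum_cons]
    exact (hf a (by simp)).add (ih fun i hi => hf i (by simp [hi]))

/-- A mapping into Euclidean space is DC as soon as its coordinates are. -/
theorem isDCMapOn_of_coord {E ι : Type*} [NormedAddCommGroup E] [NormedSpace ℝ E] [Fintype ι]
    {C : Set E} (hC : Convex ℝ C) {F : E → EuclideanSpace ℝ ι}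
    (hF : ∀ i, IsDCOn C fun x => F x i) : IsDCMapOn C F := by
  classical
  intro ℓ
  refine (IsDCOn.sum hC Finset.univ fun i _ =>
    (hF i).const_mul (ℓ (EuclideanSpace.basisFun ι ℝ i))).congr fun x _ => ?_
  conv_lhs => rw [← (EuclideanSpace.basisFun ι ℝ).sum_repr (F x)]
  simp [mul_comm]

theorem IsDCMapOn.coord {E ι : Type*} [NormedAddCommGroup E] [NormedSpace ℝ E] [Fintype ι]
    {C : Set E} {F : E → EuclideanSpace ℝ ι} (hF : IsDCMapOn C F) (i : ι) :
    IsDCOn C fun x => F x i :=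
  hF (EuclideanSpace.proj (𝕜 := ℝ) i : EuclideanSpace ℝ ι →L[ℝ] ℝ).toLinearMap

theorem IsDCMapOn.mono {E F' : Type*} [NormedAddCommGroup E] [NormedSpace ℝ E]
    [NormedAddCommGroup F'] [NormedSpace ℝ F'] {C D : Set E} {F : E → F'}
    (hF : IsDCMapOn C F) (hD : Convex ℝ D) (hDC : D ⊆ C) : IsDCMapOn D F :=
  fun ℓ => (hF ℓ).mono hD hDC

theorem IsDCMapOn.continuousOn {E ι : Type*} [NormedAddCommGroup E] [NormedSpace ℝ E] [Fintype ι]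
    {C : Set E} {F : E → EuclideanSpace ℝ ι} (hF : IsDCMapOn C F) : ContinuousOn F C :=
  (PiLp.continuous_toLp 2 fun _ : ι => ℝ).comp_continuousOn
    (continuousOn_pi.2 fun i => (hF.coord i).continuousOn)

theorem EuclideanSpace.norm_le_sum_abs {ι : Type*} [Fintype ι] (v : EuclideanSpace ℝ ι) :
    ‖v‖ ≤ ∑ i, |v i| := by
  classical
  conv_lhs => rw [← (EuclideanSpace.basisFun ι ℝ).sum_repr v]
  refine (norm_sum_le _ _).trans (Finset.sum_le_sum fun i _ => ?_)
  simp [norm_smul]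

/-- A DC mapping into Euclidean space has a continuous control function, whose convexity defect
dominates the norm of the convexity defect of the mapping. -/
theorem IsDCMapOn.exists_control {E ι : Type*} [NormedAddCommGroup E] [NormedSpace ℝ E] [Fintype ι]
    {C : Set E} {F : E → EuclideanSpace ℝ ι} (hF : IsDCMapOn C F) :
    ∃ c : E → ℝ, ContinuousOn c C ∧ ∀ x ∈ C, ∀ y ∈ C, ∀ a b : ℝ, 0 ≤ a → 0 ≤ b → a + b = 1 →
      a • x + b • y ∈ C →
      ‖F (a • x + b • y) - (a • F x + b • F y)‖ ≤ a * c x + b * c y - c (a • x + b • y) := by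
  choose g h hg hh hgc hhc hfgh using hF.coord
  refine ⟨fun x => ∑ i, (g i x + h i x),
    continuousOn_finsetSum _ fun i _ => (hgc i).add (hhc i), ?_⟩
  intro x hx y hy a b ha hb hab hz
  refine (EuclideanSpace.norm_le_sum_abs _).trans ?_
  simp only [Finset.mul_sum]
  rw [← Finset.sum_add_distrib, ← Finset.sum_sub_distrib]
  refine Finset.sum_le_sum fun i _ => ?_
  have h₁ := (hg i).2 hx hy ha hb hab
  have h₂ := (hh i).2 hx hy ha hb hab
  simp only [PiLp.sub_apply, PiLp.add_apply, PiLp.smul_apply, smul_eq_mul] at h₁ h₂ ⊢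
  simp only [hfgh i _ hz, hfgh i x hx, hfgh i y hy, abs_le]
  constructor <;> linarith

/-- The composition of a Lipschitz convex function with a DC mapping is DC. -/
theorem ConvexOn.isDCOn_comp {E ι : Type*} [NormedAddCommGroup E] [NormedSpace ℝ E] [Fintype ι]
    {C : Set E} (hC : Convex ℝ C) {F : E → EuclideanSpace ℝ ι} (hF : IsDCMapOn C F)
    {W : Set (EuclideanSpace ℝ ι)} {φ : EuclideanSpace ℝ ι → ℝ} (hφ : ConvexOn ℝ W φ)
    {K : NNReal} (hK : LipschitzOnWith K φ W) (hFW : MapsTo F C W) :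
    IsDCOn C fun x => φ (F x) := by
  obtain ⟨c, hcc, hc⟩ := hF.exists_control
  have hKc : ContinuousOn (fun x => K * c x) C := continuousOn_const.mul hcc
  refine ⟨fun x => φ (F x) + K * c x, fun x => K * c x, ⟨hC, ?_⟩, ⟨hC, ?_⟩,
    (hK.continuousOn.comp hF.continuousOn hFW).add hKc, hKc, fun x _ => by ring⟩
  all_goals
    intro x hx y hy a b ha hb hab
    have hz := hC hx hy ha hb hab
    have h₁ := hc x hx y hy a b ha hb hab hz
    have h₂ := mul_le_mul_of_nonneg_left h₁ K.coe_nonneg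
    simp only [smul_eq_mul]
  · have h₃ := hφ.2 (hFW hx) (hFW hy) ha hb hab
    have h₄ := hK.dist_le_mul _ (hFW hz) _ (hφ.1 (hFW hx) (hFW hy) ha hb hab)
    rw [Real.dist_eq, dist_eq_norm] at h₄
    have h₅ := le_of_abs_le h₄
    simp only [smul_eq_mul] at h₃
    linarith
  · have h₃ := mul_nonneg K.coe_nonneg
      (norm_nonneg (F (a • x + b • y) - (a • F x + b • F y)))
    linarith

/-- The composition of a DC function on an open set with a DC mapping is DC near every point. -/
theorem IsDCOn.exists_isDCOn_comp {E ι : Type*} [NormedAddCommGroup E] [NormedSpace ℝ E]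
    [Fintype ι] {C : Set E} (hC : IsOpen C) {F : E → EuclideanSpace ℝ ι} (hF : IsDCMapOn C F)
    {W : Set (EuclideanSpace ℝ ι)} (hW : IsOpen W) {f : EuclideanSpace ℝ ι → ℝ}
    (hf : IsDCOn W f) {x : E} (hx : x ∈ C) (hxW : F x ∈ W) :
    ∃ D : Set E, IsOpen D ∧ Convex ℝ D ∧ x ∈ D ∧ D ⊆ C ∧ IsDCOn D fun y => f (F y) := by
  obtain ⟨g, h, hg, hh, -, -, hfgh⟩ := hf
  obtain ⟨K, s, hs, hgK⟩ := hg.locallyLipschitzOn hW hxW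
  obtain ⟨L, t, ht, hhL⟩ := hh.locallyLipschitzOn hW hxW
  rw [hW.nhdsWithin_eq hxW] at hs ht
  obtain ⟨r, hr, hrB⟩ := Metric.mem_nhds_iff.1
    (Filter.inter_mem (Filter.inter_mem hs ht) (hW.mem_nhds hxW))
  have hFx : ContinuousAt F x := hF.continuousOn.continuousAt (hC.mem_nhds hx)
  obtain ⟨δ, hδ, hδB⟩ := Metric.mem_nhds_iff.1
    (Filter.inter_mem (hC.mem_nhds hx) (hFx (Metric.ball_mem_nhds (F x) hr)))
  have hD : Convex ℝ (Metric.ball x δ) := convex_ball x δ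
  have hB : Convex ℝ (Metric.ball (F x) r) := convex_ball (F x) r
  have hDC : Metric.ball x δ ⊆ C := fun y hy => (hδB hy).1
  have hDB : MapsTo F (Metric.ball x δ) (Metric.ball (F x) r) := fun y hy => (hδB hy).2
  have hBW : Metric.ball (F x) r ⊆ W := fun y hy => (hrB hy).2
  have hFD := hF.mono hD hDC
  refine ⟨Metric.ball x δ, Metric.isOpen_ball, hD, Metric.mem_ball_self hδ, hDC, ?_⟩
  refine ((ConvexOn.isDCOn_comp hD hFD (hg.subset hBW hB)
    (hgK.mono fun y hy => (hrB hy).1.1) hDB).sub (ConvexOn.isDCOn_comp hD hFD (hh.subset hBW hB)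
    (hhL.mono fun y hy => (hrB hy).1.2) hDB)).congr fun y hy => ?_
  exact hfgh _ (hBW (hDB hy))

/-- Let `U ⊆ ℝⁿ`, `V ⊆ ℝᵐ` be open, `F : U → ℝᵐ` locally DC with
`F(U) ⊆ V`, and `G : V → ℝᵏ` locally DC. Then `G ∘ F` is locally DC on `U`. -/
theorem locallyDCMapOn_comp (n m k : ℕ)
    (U : Set (EuclideanSpace ℝ (Fin n))) (hU : IsOpen U)
    (V : Set (EuclideanSpace ℝ (Fin m))) (hV : IsOpen V)
    (F : EuclideanSpace ℝ (Fin n) → EuclideanSpace ℝ (Fin m))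
    (G : EuclideanSpace ℝ (Fin m) → EuclideanSpace ℝ (Fin k))
    (hF : LocallyDCMapOn U F) (hFU : MapsTo F U V) (hG : LocallyDCMapOn V G) :
    LocallyDCMapOn U (G ∘ F) := by
  intro x hx
  obtain ⟨C, hCo, hC, hxC, hCU, hFC⟩ := hF x hx
  obtain ⟨W, hWo, -, hxW, -, hGW⟩ := hG (F x) (hFU hx)
  choose D hDo hD hxD hDC hGD using fun i =>
    (hGW.coord i).exists_isDCOn_comp hCo hFC hWo hxC hxW
  have hCD : Convex ℝ (C ∩ ⋂ i, D i) := hC.inter (convex_iInter hD)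
  refine ⟨C ∩ ⋂ i, D i, hCo.inter (isOpen_iInter_of_finite hDo), hCD,
    ⟨hxC, mem_iInter.2 hxD⟩, inter_subset_left.trans hCU, ?_⟩
  exact isDCMapOn_of_coord hCD fun i =>
    (hGD i).mono hCD (inter_subset_right.trans (iInter_subset D i))
end

section
/- Let n ≥ 2, let V ⊆ ℝⁿ be an open convex set, and let f : V → ℝ^m be a DC mapping. Then there exists a sequence (T_i)_{i∈ℕ} of (n−1)-dimensional DC surfaces in ℝⁿ such that f is strictly differentiable at every point of V ∖ ⋃_{i∈ℕ} T_i. -/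
open Set

/-- A `k`-dimensional DC surface: a nonempty set which is locally the graph of a locally DC
mapping from (an open subset of) a `k`-dimensional linear subspace `Q` to `Qᗮ`. -/
def IsDCSurface {E : Type*} [NormedAddCommGroup E] [InnerProductSpace ℝ E]
    (k : ℕ) (T : Set E) : Prop :=
  T.Nonempty ∧ ∀ x ∈ T, ∃ Q : Submodule ℝ E, Module.finrank ℝ Q = k ∧
    ∃ W : Set E, IsOpen W ∧ x ∈ W ∧ ∃ G : Set Q, IsOpen G ∧
      ∃ h : Q → Qᗮ, LocallyDCMapOn G h ∧
        T ∩ W = (fun u : Q => (u : E) + ((h u : Qᗮ) : E)) '' G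

open Filter Topology Metric

/-- The set `S` is contained in a countable union of `k`-dimensional DC surfaces. -/
def IsDCSigmaCovered {E : Type*} [NormedAddCommGroup E] [InnerProductSpace ℝ E]
    (k : ℕ) (S : Set E) : Prop :=
  ∃ 𝒯 : Set (Set E), 𝒯.Countable ∧ (∀ T ∈ 𝒯, IsDCSurface k T) ∧ S ⊆ ⋃₀ 𝒯

section Covering

variable {E : Type*} [NormedAddCommGroup E] [InnerProductSpace ℝ E]

lemma IsDCSigmaCovered.mono {k : ℕ} {S S' : Set E} (h : IsDCSigmaCovered k S') (hS : S ⊆ S') :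
    IsDCSigmaCovered k S := by
  obtain ⟨𝒯, h1, h2, h3⟩ := h
  exact ⟨𝒯, h1, h2, hS.trans h3⟩

lemma IsDCSigmaCovered.biUnion {k : ℕ} {ι : Type*} {I : Set ι} (hI : I.Countable)
    {S : ι → Set E} (h : ∀ i ∈ I, IsDCSigmaCovered k (S i)) :
    IsDCSigmaCovered k (⋃ i ∈ I, S i) := by
  choose! 𝒯 h1 h2 h3 using h
  refine ⟨⋃ i ∈ I, 𝒯 i, hI.biUnion h1, ?_, ?_⟩
  · simp only [mem_iUnion]
    rintro T ⟨i, hi, hT⟩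
    exact h2 i hi T hT
  · refine iUnion₂_subset fun i hi => (h3 i hi).trans ?_
    exact sUnion_subset_sUnion (subset_biUnion_of_mem hi)

lemma IsDCSigmaCovered.iUnion {k : ℕ} {ι : Type*} [Countable ι]
    {S : ι → Set E} (h : ∀ i, IsDCSigmaCovered k (S i)) :
    IsDCSigmaCovered k (⋃ i, S i) := by
  have := IsDCSigmaCovered.biUnion (countable_univ (α := ι)) (S := S) fun i _ => h i
  simpa using this

lemma IsDCSigmaCovered.exists_seq {k : ℕ} {S : Set E} (h : IsDCSigmaCovered k S)
    (hne : ∃ T : Set E, IsDCSurface k T) :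
    ∃ T : ℕ → Set E, (∀ i, IsDCSurface k (T i)) ∧ S ⊆ ⋃ i, T i := by
  obtain ⟨𝒯, h1, h2, h3⟩ := h
  obtain ⟨T₀, hT₀⟩ := hne
  obtain ⟨T, hT⟩ := (h1.insert T₀).exists_eq_range (insert_nonempty _ _)
  refine ⟨T, fun i => ?_, ?_⟩
  · have : T i ∈ insert T₀ 𝒯 := hT ▸ mem_range_self i
    rcases this with h | h
    · exact h ▸ hT₀
    · exact h2 _ h
  · rw [← sUnion_range, ← hT]
    exact h3.trans (sUnion_subset_sUnion (subset_insert _ _))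

/-- Graphs of differences of convex functions over the orthogonal complement of a line. -/
lemma isDCSurface_graph [FiniteDimensional ℝ E] {k : ℕ} (hk : Module.finrank ℝ E = k + 1)
    {e : E} (he : e ≠ 0) {G : Set (ℝ ∙ e)ᗮ} (hG : IsOpen G) (hne : G.Nonempty)
    {a b : (ℝ ∙ e)ᗮ → ℝ} (ha : ConvexOn ℝ G a) (hb : ConvexOn ℝ G b) :
    IsDCSurface k ((fun u : (ℝ ∙ e)ᗮ => (u : E) + (a u - b u) • e) '' G) := by
  have : Fact (Module.finrank ℝ E = k + 1) := ⟨hk⟩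
  have heQ : e ∈ (ℝ ∙ e)ᗮᗮ :=
    Submodule.le_orthogonal_orthogonal _ (Submodule.mem_span_singleton_self e)
  refine ⟨hne.image _, fun x _ => ⟨(ℝ ∙ e)ᗮ, Submodule.finrank_orthogonal_span_singleton he,
    univ, isOpen_univ, mem_univ _, G, hG, fun u => (a u - b u) • ⟨e, heQ⟩, ?_, ?_⟩⟩
  · intro u hu
    refine ⟨G, hG, ha.1, hu, subset_rfl, fun ℓ => ?_⟩
    set c := ℓ ⟨e, heQ⟩ with hc
    have hac := ha.continuousOn hG
    have hbc := hb.continuousOn hG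
    rcases le_total 0 c with h | h
    · refine ⟨fun u => c • a u, fun u => c • b u, ha.smul h, hb.smul h, hac.const_smul c,
        hbc.const_smul c, fun u _ => ?_⟩
      simp only [map_smul, smul_eq_mul, ← hc]
      ring
    · refine ⟨fun u => (-c) • b u, fun u => (-c) • a u, hb.smul (neg_nonneg.2 h),
        ha.smul (neg_nonneg.2 h), hbc.const_smul (-c), hac.const_smul (-c), fun u _ => ?_⟩
      simp only [map_smul, smul_eq_mul, ← hc]
      ring
  · simp

/-- The infimum of `p` over the part of the line `u + ℝ e` lying in `B`. -/
noncomputable def lineInf (B : Set E) (p : E → ℝ) (e : E) (u : (ℝ ∙ e)ᗮ) : ℝ :=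
  sInf (p '' {y | y ∈ B ∧ ∃ t : ℝ, y = u + t • e})

lemma convexOn_lineInf {B : Set E} {p : E → ℝ} (hp : ConvexOn ℝ B p) {M : ℝ}
    (hM : ∀ y ∈ B, M ≤ p y) (e : E) :
    ConvexOn ℝ {u : (ℝ ∙ e)ᗮ | ∃ t : ℝ, (u : E) + t • e ∈ B} (lineInf B p e) := by
  have key : ∀ (a b : ℝ) (u v : (ℝ ∙ e)ᗮ) (s t : ℝ),
      a • ((u : E) + s • e) + b • ((v : E) + t • e) =
        ((a • u + b • v : (ℝ ∙ e)ᗮ) : E) + (a * s + b * t) • e := by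
    intro a b u v s t
    push_cast
    module
  refine ⟨?_, ?_⟩
  · rintro u ⟨s, hs⟩ v ⟨t, ht⟩ a b ha hb hab
    exact ⟨a * s + b * t, key a b u v s t ▸ hp.1 hs ht ha hb hab⟩
  · rintro u ⟨s, hs⟩ v ⟨t, ht⟩ a b ha hb hab
    refine le_of_forall_pos_le_add fun ε hε => ?_
    have approx : ∀ (w : (ℝ ∙ e)ᗮ) (r : ℝ), (w : E) + r • e ∈ B →
        ∃ r' : ℝ, (w : E) + r' • e ∈ B ∧ p (w + r' • e) < lineInf B p e w + ε := by
      intro w r hr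
      obtain ⟨_, ⟨y, ⟨hyB, r', rfl⟩, rfl⟩, hlt⟩ := Real.lt_sInf_add_pos
        (s := p '' {y | y ∈ B ∧ ∃ t : ℝ, y = w + t • e}) ⟨_, _, ⟨hr, r, rfl⟩, rfl⟩ hε
      exact ⟨r', hyB, hlt⟩
    obtain ⟨s', hs', hs''⟩ := approx u s hs
    obtain ⟨t', ht', ht''⟩ := approx v t ht
    have h1 := hp.2 hs' ht' ha hb hab
    have h2 := hp.1 hs' ht' ha hb hab
    rw [key] at h1 h2
    have h3 : lineInf B p e (a • u + b • v) ≤ p (((a • u + b • v : (ℝ ∙ e)ᗮ) : E)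
        + (a * s' + b * t') • e) := by
      refine csInf_le ⟨M, ?_⟩ ⟨_, ⟨h2, _, rfl⟩, rfl⟩
      rintro _ ⟨y, ⟨hy, -⟩, rfl⟩
      exact hM y hy
    simp only [smul_eq_mul] at h1 ⊢
    have h4 := mul_le_mul_of_nonneg_left hs''.le ha
    have h5 := mul_le_mul_of_nonneg_left ht''.le hb
    have h6 : a * ε + b * ε = ε := by rw [← add_mul, hab, one_mul]
    linarith

lemma lineInf_eq {B : Set E} {p : E → ℝ} {e : E} {u : (ℝ ∙ e)ᗮ} {s : ℝ}
    (hs : (u : E) + s • e ∈ B)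
    (hmin : ∀ t : ℝ, (u : E) + t • e ∈ B → p (u + s • e) ≤ p (u + t • e)) :
    lineInf B p e u = p (u + s • e) := by
  refine IsLeast.csInf_eq ⟨⟨_, ⟨hs, s, rfl⟩, rfl⟩, ?_⟩
  rintro _ ⟨y, ⟨hy, t, rfl⟩, rfl⟩
  exact hmin t hy

/-- If two convex functions differ by a nonzero multiple of `⟪e, ·⟫`, the points at which both
are minimal along the direction `e` lie on a DC surface. -/
lemma exists_isDCSurface_of_minimal [FiniteDimensional ℝ E] {k : ℕ}
    (hk : Module.finrank ℝ E = k + 1) {e : E} (he : ‖e‖ = 1) {B : Set E} (hB : IsOpen B)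
    (hne : B.Nonempty) {p q : E → ℝ} (hp : ConvexOn ℝ B p) (hq : ConvexOn ℝ B q) {M : ℝ}
    (hpM : ∀ y ∈ B, M ≤ p y) (hqM : ∀ y ∈ B, M ≤ q y) {c : ℝ} (hc : 0 < c)
    (hpq : ∀ y ∈ B, p y - q y = c * inner ℝ e y) :
    ∃ T : Set E, IsDCSurface k T ∧
      {x | x ∈ B ∧ ∀ t : ℝ, x + t • e ∈ B → p x ≤ p (x + t • e) ∧ q x ≤ q (x + t • e)} ⊆ T := by
  have he0 : e ≠ 0 := by
    rintro rfl
    simp at he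
  set G : Set (ℝ ∙ e)ᗮ := {u | ∃ t : ℝ, (u : E) + t • e ∈ B} with hG
  have hdecomp : ∀ x : E, ∃ u : (ℝ ∙ e)ᗮ, x = u + (inner ℝ e x : ℝ) • e := by
    intro x
    refine ⟨⟨x - (inner ℝ e x : ℝ) • e, ?_⟩, by simp⟩
    rw [Submodule.mem_orthogonal_singleton_iff_inner_right, inner_sub_right, inner_smul_right,
      real_inner_self_eq_norm_sq, he]
    ring
  have hGo : IsOpen G := by
    have : G = ⋃ t : ℝ, (fun u : (ℝ ∙ e)ᗮ => (u : E) + t • e) ⁻¹' B := by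
      ext u
      simp [hG]
    rw [this]
    exact isOpen_iUnion fun t => hB.preimage (by fun_prop)
  have hGne : G.Nonempty := by
    obtain ⟨x, hx⟩ := hne
    obtain ⟨u, hu⟩ := hdecomp x
    exact ⟨u, _, hu ▸ hx⟩
  have hci : 0 ≤ c⁻¹ := (inv_pos.2 hc).le
  refine ⟨_, isDCSurface_graph hk he0 hGo hGne ((convexOn_lineInf hp hpM e).smul hci)
    ((convexOn_lineInf hq hqM e).smul hci), ?_⟩
  rintro x ⟨hxB, hx⟩
  obtain ⟨u, hu⟩ := hdecomp x
  set s : ℝ := inner ℝ e x with hs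
  have hsB : (u : E) + s • e ∈ B := hu ▸ hxB
  have hshift : ∀ t : ℝ, (u : E) + t • e = x + (t - s) • e := by
    intro t
    rw [hu]
    module
  have hpu : lineInf B p e u = p x := by
    rw [lineInf_eq hsB fun t ht => ?_, ← hu]
    rw [← hu, hshift t]
    exact (hx _ (hshift t ▸ ht)).1
  have hqu : lineInf B q e u = q x := by
    rw [lineInf_eq hsB fun t ht => ?_, ← hu]
    rw [← hu, hshift t]
    exact (hx _ (hshift t ▸ ht)).2
  refine ⟨u, ⟨s, hsB⟩, ?_⟩
  have h1 : c⁻¹ • p x - c⁻¹ • q x = s := by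
    rw [← smul_sub, hpq x hxB, smul_eq_mul, inv_mul_cancel_left₀ hc.ne']
  simp only [hpu, hqu, h1]
  exact hu.symm

end Covering

section Differentiability

/-- A convex function on an interval that is not differentiable at an interior point has two
distinct rational subgradients there. -/
lemma ConvexOn.exists_rat_subgradients {S : Set ℝ} {γ : ℝ → ℝ} (hγ : ConvexOn ℝ S γ) {s : ℝ}
    (hs : s ∈ interior S) (hd : ¬ DifferentiableAt ℝ γ s) :
    ∃ α β : ℚ, α < β ∧ ∀ t ∈ S, γ s + α * (t - s) ≤ γ t ∧ γ s + β * (t - s) ≤ γ t := by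
  have hl := hγ.hasDerivWithinAt_leftDeriv_of_mem_interior hs
  have hr := hγ.hasDerivWithinAt_rightDeriv_of_mem_interior hs
  have hle := hγ.leftDeriv_le_rightDeriv_of_mem_interior hs
  have hlt : derivWithin γ (Iio s) s < derivWithin γ (Ioi s) s := by
    refine lt_of_le_of_ne hle fun heq => hd ?_
    rw [heq] at hl
    have h := (hasDerivWithinAt_Iio_iff_Iic.1 hl).union (hasDerivWithinAt_Ioi_iff_Ici.1 hr)
    rw [Iic_union_Ici, hasDerivWithinAt_univ] at h
    exact h.differentiableAt
  obtain ⟨α, hα, hα'⟩ := exists_rat_btwn hlt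
  obtain ⟨β, hβ, hβ'⟩ := exists_rat_btwn hα'
  have key : ∀ a : ℝ, derivWithin γ (Iio s) s < a → a < derivWithin γ (Ioi s) s →
      ∀ t ∈ S, γ s + a * (t - s) ≤ γ t := by
    intro a h1 h2 t ht
    rcases lt_trichotomy t s with h | rfl | h
    · have h3 := (hγ.slope_le_leftDeriv_of_mem_interior ht hs h).trans h1.le
      rw [slope_def_field, div_le_iff₀ (sub_pos.2 h)] at h3
      linarith
    · simp
    · have h3 := h2.le.trans (hγ.rightDeriv_le_slope_of_mem_interior hs ht h)
      rw [slope_def_field, le_div_iff₀ (sub_pos.2 h)] at h3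
      linarith
  exact ⟨α, β, by exact_mod_cast hβ, fun t ht =>
    ⟨key α hα hα' t ht, key β (hα.trans hβ) hβ' t ht⟩⟩

variable {E : Type*} [NormedAddCommGroup E] [InnerProductSpace ℝ E] [FiniteDimensional ℝ E]

lemma isDCSigmaCovered_subgradients {k : ℕ}
    (hk : Module.finrank ℝ E = k + 1) {e : E} (he : ‖e‖ = 1) {V : Set E} (hV : IsOpen V)
    {g : E → ℝ} (hg : ConvexOn ℝ V g) {α β : ℝ} (hαβ : α < β) :
    IsDCSigmaCovered k {x | x ∈ V ∧ ∀ t : ℝ, x + t • e ∈ V →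
      g x + α * t ≤ g (x + t • e) ∧ g x + β * t ≤ g (x + t • e)} := by
  have hgc := hg.continuousOn hV
  have hconv : ∀ a : ℝ, ConvexOn ℝ V fun y => g y - a * inner ℝ e y := by
    intro a
    refine hg.sub ⟨hg.1, fun x _ y _ b c _ _ _ => le_of_eq ?_⟩
    simp only [inner_add_right, inner_smul_right, smul_eq_mul]
    ring
  have hcont : ∀ a : ℝ, ContinuousOn (fun y => g y - a * inner ℝ e y) V := fun a =>
    hgc.sub (by fun_prop)
  have hball : ∀ x ∈ V, ∃ r > 0, ball x r ⊆ V ∧ ∃ M : ℝ, ∀ y ∈ ball x r,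
      M ≤ g y - α * inner ℝ e y ∧ M ≤ g y - β * inner ℝ e y := by
    intro x hx
    have h1 := ((hcont α).continuousAt (hV.mem_nhds hx)).eventually_const_le
      (sub_one_lt (g x - α * inner ℝ e x))
    have h2 := ((hcont β).continuousAt (hV.mem_nhds hx)).eventually_const_le
      (sub_one_lt (g x - β * inner ℝ e x))
    obtain ⟨r, hr, h⟩ := Metric.eventually_nhds_iff_ball.1 ((h1.and h2).and (hV.mem_nhds hx))
    exact ⟨r, hr, fun y hy => (h y hy).2, _, fun y hy =>
      ⟨(min_le_left _ _).trans (h y hy).1.1, (min_le_right _ _).trans (h y hy).1.2⟩⟩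
  choose! r hr hrV M hM using hball
  obtain ⟨D, hDV, hDc, hD⟩ := TopologicalSpace.countable_cover_nhdsWithin
    (s := V) (f := fun x => ball x (r x))
    fun x hx => mem_nhdsWithin_of_mem_nhds (ball_mem_nhds x (hr x hx))
  have hcov : ∀ z ∈ D, IsDCSigmaCovered k {x | x ∈ ball z (r z) ∧
      ∀ t : ℝ, x + t • e ∈ ball z (r z) →
        g x - α * inner ℝ e x ≤ g (x + t • e) - α * inner ℝ e (x + t • e) ∧
        g x - β * inner ℝ e x ≤ g (x + t • e) - β * inner ℝ e (x + t • e)} := by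
    intro z hz
    have hzV := hDV hz
    obtain ⟨T, hT, hsub⟩ := exists_isDCSurface_of_minimal hk he isOpen_ball
      (nonempty_ball.2 (hr z hzV))
      ((hconv α).subset (hrV z hzV) (convex_ball _ _))
      ((hconv β).subset (hrV z hzV) (convex_ball _ _))
      (fun y hy => (hM z hzV y hy).1) (fun y hy => (hM z hzV y hy).2)
      (sub_pos.2 hαβ) (fun y _ => by ring)
    exact ⟨{T}, countable_singleton T, by simpa using hT, by simpa using hsub⟩
  refine (IsDCSigmaCovered.biUnion hDc hcov).mono ?_
  rintro x ⟨hxV, hx⟩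
  obtain ⟨z, hz, hxz⟩ := mem_iUnion₂.1 (hD hxV)
  refine mem_iUnion₂.2 ⟨z, hz, hxz, fun t ht => ?_⟩
  have h := hx t (hrV z (hDV hz) ht)
  have hin : inner ℝ e (x + t • e) = inner ℝ e x + t := by
    rw [inner_add_right, inner_smul_right, real_inner_self_eq_norm_sq, he]
    ring
  rw [hin]
  constructor
  · linarith [h.1]
  · linarith [h.2]

/-- The points where a convex function has no derivative in the direction `e` are covered by
countably many DC surfaces. -/
lemma isDCSigmaCovered_not_differentiableAt_line {k : ℕ}
    (hk : Module.finrank ℝ E = k + 1) {e : E} (he : ‖e‖ = 1) {V : Set E} (hV : IsOpen V)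
    {g : E → ℝ} (hg : ConvexOn ℝ V g) :
    IsDCSigmaCovered k {x | x ∈ V ∧ ¬ DifferentiableAt ℝ (fun t : ℝ => g (x + t • e)) 0} := by
  have hcov : ∀ ab : {ab : ℚ × ℚ // ab.1 < ab.2}, IsDCSigmaCovered k
      {x | x ∈ V ∧ ∀ t : ℝ, x + t • e ∈ V →
        g x + (ab.1.1 : ℝ) * t ≤ g (x + t • e) ∧ g x + (ab.1.2 : ℝ) * t ≤ g (x + t • e)} :=
    fun ab => isDCSigmaCovered_subgradients hk he hV hg (by exact_mod_cast ab.2)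
  refine (IsDCSigmaCovered.iUnion hcov).mono ?_
  rintro x ⟨hxV, hx⟩
  have hline : ConvexOn ℝ {t : ℝ | x + t • e ∈ V} fun t : ℝ => g (x + t • e) := by
    have h := hg.comp_affineMap (AffineMap.lineMap x (x + e) : ℝ →ᵃ[ℝ] E)
    have h' : ∀ t : ℝ, AffineMap.lineMap x (x + e) t = x + t • e := fun t => by
      simp [AffineMap.lineMap_apply, add_comm]
    simpa only [Function.comp_def, preimage, h'] using h
  have h0 : (0 : ℝ) ∈ interior {t : ℝ | x + t • e ∈ V} := by
    have ho : IsOpen {t : ℝ | x + t • e ∈ V} :=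
      hV.preimage (f := fun t : ℝ => x + t • e) (by fun_prop)
    rw [ho.interior_eq]
    simpa using hxV
  obtain ⟨α, β, hαβ, h⟩ := hline.exists_rat_subgradients h0 hx
  refine mem_iUnion.2 ⟨⟨(α, β), hαβ⟩, hxV, fun t ht => ?_⟩
  simpa using h t ht

/-- A convex function with all partial derivatives at a point is strictly differentiable there. -/
lemma ConvexOn.exists_hasStrictFDerivAt {ι : Type*} [Fintype ι] [Nonempty ι]
    (b : OrthonormalBasis ι ℝ E) {V : Set E} (hV : IsOpen V) {g : E → ℝ} (hg : ConvexOn ℝ V g)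
    {x : E} (hx : x ∈ V)
    (hd : ∀ i, DifferentiableAt ℝ (fun t : ℝ => g (x + t • b i)) 0) :
    ∃ L : E →L[ℝ] ℝ, HasStrictFDerivAt g L x := by
  set L₀ : E →ₗ[ℝ] ℝ := b.toBasis.constr ℝ fun i => deriv (fun t : ℝ => g (x + t • b i)) 0
  set L : E →L[ℝ] ℝ := L₀.toContinuousLinearMap
  have hL : ∀ i, L (b i) = deriv (fun t : ℝ => g (x + t • b i)) 0 := by
    intro i
    have := b.toBasis.constr_basis ℝ (fun i => deriv (fun t : ℝ => g (x + t • b i)) 0) i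
    rwa [OrthonormalBasis.coe_toBasis] at this
  set ψ : E → ℝ := fun y => g y - (g x + L (y - x)) with hψ
  have hψc : ConvexOn ℝ V ψ := by
    refine hg.sub ⟨hg.1, fun y _ z _ s t _ _ hst => le_of_eq ?_⟩
    simp only [map_sub, map_add, map_smul, smul_eq_mul]
    linear_combination (g x - L x) * hst
  have hψx : ψ x = 0 := by simp [hψ]
  obtain ⟨N, hN⟩ : ∃ N : ℝ, N = Fintype.card ι := ⟨_, rfl⟩
  have hNpos : 0 < N := by
    rw [hN]
    exact_mod_cast Fintype.card_pos
  have hsmall : ∀ c > 0, ∃ r > 0, ball x r ⊆ V ∧ ∀ y ∈ ball x r, |ψ y| ≤ c * r := by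
    intro c hc
    have hev : ∀ i, ∀ᶠ t : ℝ in 𝓝 0, x + t • b i ∈ V ∧ |ψ (x + t • b i)| ≤ c / N * |t| := by
      intro i
      have h1 : ∀ᶠ t : ℝ in 𝓝 0, x + t • b i ∈ V := by
        have hcont : Continuous fun t : ℝ => x + t • b i := by fun_prop
        exact hcont.continuousAt.eventually_mem (hV.mem_nhds (by simpa using hx))
      have h2 := (hasDerivAt_iff_isLittleO.1 (hd i).hasDerivAt).bound (div_pos hc hNpos)
      filter_upwards [h1, h2] with t ht1 ht2
      refine ⟨ht1, ?_⟩
      have : ψ (x + t • b i) = g (x + t • b i) - g (x + (0 : ℝ) • b i)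
          - (t - 0) • deriv (fun t : ℝ => g (x + t • b i)) 0 := by
        simp only [hψ, add_sub_cancel_left, map_smul, hL, zero_smul, add_zero, sub_zero]
        ring
      rw [this]
      simpa using ht2
    obtain ⟨δ, hδ, hδ'⟩ := Metric.eventually_nhds_iff_ball.1 (eventually_all.2 hev)
    obtain ⟨R, hR, hRV⟩ := Metric.isOpen_iff.1 hV x hx
    have hrpos : 0 < min (δ / N) R := lt_min (div_pos hδ hNpos) hR
    have hupper : ∀ y ∈ ball x (min (δ / N) R), ψ y ≤ c * min (δ / N) R := by
      intro y hy
      set r := min (δ / N) R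
      have hyr : ‖y - x‖ < r := by rwa [mem_ball_iff_norm] at hy
      have hcoord : ∀ i, |b.repr (y - x) i| ≤ ‖y - x‖ := fun i => by
        rw [b.repr_apply_apply]
        simpa using abs_real_inner_le_norm (b i) (y - x)
      have hNi : ∀ i, |N * b.repr (y - x) i| < δ := fun i => by
        rw [abs_mul, abs_of_pos hNpos]
        calc N * |b.repr (y - x) i| < N * (δ / N) :=
              mul_lt_mul_of_pos_left (((hcoord i).trans_lt hyr).trans_le (min_le_left _ _)) hNpos
          _ = δ := mul_div_cancel₀ _ hNpos.ne'
      have hpt : ∀ i, x + (N * b.repr (y - x) i) • b i ∈ V ∧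
          |ψ (x + (N * b.repr (y - x) i) • b i)| ≤ c / N * |N * b.repr (y - x) i| :=
        fun i => hδ' _ (by simpa using hNi i) i
      have hsum1 : ∑ _i : ι, N⁻¹ = 1 := by
        simp [← hN, hNpos.ne']
      have hsum : ∑ i, N⁻¹ • (x + (N * b.repr (y - x) i) • b i) = y := by
        have h1 : ∀ i, N⁻¹ • (x + (N * b.repr (y - x) i) • b i)
            = N⁻¹ • x + b.repr (y - x) i • b i := fun i => by
          rw [smul_add, smul_smul, inv_mul_cancel_left₀ hNpos.ne']
        rw [Finset.sum_congr rfl fun i _ => h1 i, Finset.sum_add_distrib, ← Finset.sum_smul,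
          hsum1, b.sum_repr, one_smul, add_sub_cancel]
      have hJ := hψc.map_sum_le (t := Finset.univ) (w := fun _ : ι => N⁻¹)
        (p := fun i => x + (N * b.repr (y - x) i) • b i) (fun i _ => (inv_pos.2 hNpos).le) hsum1
        (fun i _ => (hpt i).1)
      rw [hsum] at hJ
      refine hJ.trans ?_
      calc ∑ i, N⁻¹ • ψ (x + (N * b.repr (y - x) i) • b i) ≤ ∑ _i : ι, N⁻¹ * (c * r) := by
            refine Finset.sum_le_sum fun i _ => ?_
            rw [smul_eq_mul]
            refine mul_le_mul_of_nonneg_left ?_ (inv_pos.2 hNpos).le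
            refine (le_abs_self _).trans ((hpt i).2.trans ?_)
            rw [abs_mul, abs_of_pos hNpos, ← mul_assoc, div_mul_cancel₀ _ hNpos.ne']
            exact mul_le_mul_of_nonneg_left ((hcoord i).trans hyr.le) hc.le
        _ = c * r := by rw [← Finset.sum_mul, hsum1, one_mul]
    have hballV : ball x (min (δ / N) R) ⊆ V :=
      (ball_subset_ball (min_le_right _ _)).trans hRV
    refine ⟨_, hrpos, hballV, fun y hy => abs_le.2 ⟨?_, hupper y hy⟩⟩
    have hy' : (2 : ℝ) • x - y ∈ ball x (min (δ / N) R) := by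
      rw [mem_ball_iff_norm] at hy ⊢
      rwa [show (2 : ℝ) • x - y - x = -(y - x) by module, norm_neg]
    have hmid := hψc.2 (hballV hy) (hballV hy') (by norm_num : (0 : ℝ) ≤ 1 / 2)
      (by norm_num : (0 : ℝ) ≤ 1 / 2) (by norm_num)
    rw [show (1 / 2 : ℝ) • y + (1 / 2 : ℝ) • ((2 : ℝ) • x - y) = x by module, hψx] at hmid
    simp only [smul_eq_mul] at hmid
    linarith [hupper _ hy']
  refine ⟨L, .of_isLittleO (Asymptotics.IsLittleO.of_bound fun c hc => ?_)⟩
  obtain ⟨r, hr, hrV, hb⟩ := hsmall (c / 4) (by positivity)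
  have hlip := (hψc.subset hrV (convex_ball _ _)).lipschitzOnWith_of_abs_le (half_pos hr)
    fun y hy => hb y hy
  have hconst : 2 * (c / 4 * r) / (r / 2) = c := by
    field_simp
    ring
  rw [hconst, sub_half] at hlip
  filter_upwards [prod_mem_nhds (ball_mem_nhds x (half_pos hr)) (ball_mem_nhds x (half_pos hr))]
    with p hp
  have h := hlip.dist_le_mul p.1 hp.1 p.2 hp.2
  rw [Real.coe_toNNReal _ hc.le, dist_eq_norm, dist_eq_norm] at h
  refine le_of_eq_of_le (congrArg norm ?_) h
  simp only [hψ, map_sub]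
  ring

/-- A convex function is strictly differentiable off countably many DC surfaces. -/
lemma ConvexOn.isDCSigmaCovered_not_hasStrictFDerivAt {k : ℕ}
    (hk : Module.finrank ℝ E = k + 1) {V : Set E} (hV : IsOpen V) {g : E → ℝ}
    (hg : ConvexOn ℝ V g) :
    IsDCSigmaCovered k {x | x ∈ V ∧ ¬ ∃ L : E →L[ℝ] ℝ, HasStrictFDerivAt g L x} := by
  have : Nonempty (Fin (Module.finrank ℝ E)) := ⟨⟨0, by omega⟩⟩
  have b := stdOrthonormalBasis ℝ E
  refine (IsDCSigmaCovered.iUnion fun i =>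
    isDCSigmaCovered_not_differentiableAt_line hk (b.norm_eq_one i) hV hg).mono ?_
  rintro x ⟨hxV, hx⟩
  by_contra hcon
  simp only [mem_iUnion, mem_ofPred_eq, not_exists, not_and, not_not] at hcon
  exact hx (hg.exists_hasStrictFDerivAt b hV hxV fun i => hcon i hxV)

lemma exists_isDCSurface {k : ℕ} (hk : Module.finrank ℝ E = k + 1) :
    ∃ T : Set E, IsDCSurface k T := by
  have : Nontrivial E := Module.nontrivial_of_finrank_pos (R := ℝ) (by omega)
  obtain ⟨e, he⟩ := exists_ne (0 : E)
  exact ⟨_, isDCSurface_graph hk he isOpen_univ univ_nonempty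
    (convexOn_const 0 convex_univ) (convexOn_const 0 convex_univ)⟩

end Differentiability

/-- Let `n ≥ 2`, `V ⊆ ℝⁿ` open convex, and `f : V → ℝᵐ` a DC mapping.
Then there is a sequence `(T i)` of `(n-1)`-dimensional DC surfaces in `ℝⁿ` such that `f`
is strictly differentiable at every point of `V ∖ ⋃ i, T i`. -/
theorem strict_differentiability_of_DC (n m : ℕ) (hn : 2 ≤ n)
    (V : Set (EuclideanSpace ℝ (Fin n))) (hV : IsOpen V) (hVconv : Convex ℝ V)
    (f : EuclideanSpace ℝ (Fin n) → EuclideanSpace ℝ (Fin m))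
    (hf : IsDCMapOn V f) :
    ∃ T : ℕ → Set (EuclideanSpace ℝ (Fin n)),
      (∀ i, IsDCSurface (n - 1) (T i)) ∧
      ∀ x ∈ V \ ⋃ i, T i,
        ∃ L : EuclideanSpace ℝ (Fin n) →L[ℝ] EuclideanSpace ℝ (Fin m),
          HasStrictFDerivAt f L x := by
  have hk : Module.finrank ℝ (EuclideanSpace ℝ (Fin n)) = n - 1 + 1 := by
    rw [finrank_euclideanSpace_fin]
    omega
  choose g h hg hh _ _ hgh using fun j : Fin m =>
    hf (EuclideanSpace.proj j : EuclideanSpace ℝ (Fin m) →L[ℝ] ℝ).toLinearMap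
  have hcov : ∀ j, IsDCSigmaCovered (n - 1)
      (⋃ φ ∈ ({g j, h j} : Set (EuclideanSpace ℝ (Fin n) → ℝ)),
        {x | x ∈ V ∧ ¬ ∃ L : EuclideanSpace ℝ (Fin n) →L[ℝ] ℝ, HasStrictFDerivAt φ L x}) := by
    refine fun j => IsDCSigmaCovered.biUnion (toFinite _).countable ?_
    rintro φ (rfl | rfl)
    · exact (hg j).isDCSigmaCovered_not_hasStrictFDerivAt hk hV
    · exact (hh j).isDCSigmaCovered_not_hasStrictFDerivAt hk hV
  obtain ⟨T, hT, hsub⟩ := (IsDCSigmaCovered.iUnion hcov).exists_seq (exists_isDCSurface hk)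
  refine ⟨T, hT, fun x hx => ?_⟩
  have hdiff : ∀ j, ∃ L : EuclideanSpace ℝ (Fin n) →L[ℝ] ℝ,
      HasStrictFDerivAt (fun y => f y j) L x := by
    intro j
    have hφ : ∀ φ ∈ ({g j, h j} : Set (EuclideanSpace ℝ (Fin n) → ℝ)),
        ∃ L : EuclideanSpace ℝ (Fin n) →L[ℝ] ℝ, HasStrictFDerivAt φ L x := by
      intro φ hφ
      by_contra hcon
      exact hx.2 (hsub (mem_iUnion.2 ⟨j, mem_iUnion₂.2 ⟨φ, hφ, hx.1, hcon⟩⟩))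
    obtain ⟨L₁, hL₁⟩ := hφ (g j) (by simp)
    obtain ⟨L₂, hL₂⟩ := hφ (h j) (by simp)
    refine ⟨L₁ - L₂, (hL₁.sub hL₂).congr_of_eventuallyEq ?_⟩
    filter_upwards [hV.mem_nhds hx.1] with y hy
    exact (hgh j y hy).symm
  choose L hL using hdiff
  refine ⟨(EuclideanSpace.equiv (Fin m) ℝ).symm.toContinuousLinearMap.comp
    (ContinuousLinearMap.pi L), hasStrictFDerivAt_euclidean.2 fun j => ?_⟩
  exact hL j
end

section
/- Let X and X_k (k ∈ ℕ) be convex surfaces in ℝ^m such that the Hausdorff distance between X_k and X tends to 0 as k → ∞. Let a, b ∈ X and a_k, b_k ∈ X_k with a_k → a and b_k → b in ℝ^m. Then dist_{X_k}(a_k, b_k) → dist_X(a, b), where dist_X and dist_{X_k} denote the intrinsic distances on X and X_k respectively. -/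
open Set Filter Metric

/-- A convex body: a compact convex set with nonempty interior. -/
def IsConvexBody {E : Type*} [NormedAddCommGroup E] [NormedSpace ℝ E] (C : Set E) : Prop :=
  IsCompact C ∧ Convex ℝ C ∧ (interior C).Nonempty

/-- A convex surface: the boundary of a convex body. -/
def IsConvexSurface {E : Type*} [NormedAddCommGroup E] [NormedSpace ℝ E] (X : Set E) : Prop :=
  ∃ C : Set E, IsConvexBody C ∧ X = frontier C

/-- The intrinsic distance on `X ⊆ E`: the infimum of lengths (total variations) of
continuous curves `γ : [0,1] → E` joining `a` and `b` within `X`. -/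
noncomputable def intrinsicDist {E : Type*} [NormedAddCommGroup E] [NormedSpace ℝ E]
    (X : Set E) (a b : E) : ℝ :=
  (⨅ γ : {γ : ℝ → E // ContinuousOn γ (Set.Icc 0 1) ∧ γ 0 = a ∧ γ 1 = b ∧
      Set.MapsTo γ (Set.Icc 0 1) X},
    eVariationOn γ.1 (Set.Icc 0 1)).toReal

/-- The extended intrinsic distance, equal to `⊤` when no rectifiable curve in `X` joins `a`
and `b`. -/
noncomputable def intrinsicEDist {E : Type*} [NormedAddCommGroup E] [NormedSpace ℝ E]
    (X : Set E) (a b : E) : ENNReal :=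
  ⨅ γ : {γ : ℝ → E // ContinuousOn γ (Set.Icc 0 1) ∧ γ 0 = a ∧ γ 1 = b ∧
      Set.MapsTo γ (Set.Icc 0 1) X},
    eVariationOn γ.1 (Set.Icc 0 1)

section Curves

variable {E : Type*} [NormedAddCommGroup E] [NormedSpace ℝ E]

theorem intrinsicDist_eq_toReal (X : Set E) (a b : E) :
    intrinsicDist X a b = (intrinsicEDist X a b).toReal := rfl

theorem intrinsicEDist_le_eVariationOn {X : Set E} {a b : E} {γ : ℝ → E}
    (hc : ContinuousOn γ (Icc 0 1)) (h0 : γ 0 = a) (h1 : γ 1 = b) (hX : MapsTo γ (Icc 0 1) X) :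
    intrinsicEDist X a b ≤ eVariationOn γ (Icc 0 1) :=
  iInf_le (fun γ : {γ : ℝ → E // ContinuousOn γ (Set.Icc 0 1) ∧ γ 0 = a ∧ γ 1 = b ∧
      Set.MapsTo γ (Set.Icc 0 1) X} => eVariationOn γ.1 (Set.Icc 0 1)) ⟨γ, hc, h0, h1, hX⟩

theorem intrinsicEDist_map_le {X Y : Set E} {f : E → E} {c : NNReal} (hc : c ≠ 0)
    (hf : LipschitzWith c f) (hXY : MapsTo f X Y) (a b : E) :
    intrinsicEDist Y (f a) (f b) ≤ c * intrinsicEDist X a b := by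
  conv_rhs => rw [intrinsicEDist]
  rw [ENNReal.mul_iInf_of_ne (by simpa using hc) ENNReal.coe_ne_top]
  refine le_iInf fun ⟨γ, hγ, h0, h1, hX⟩ => ?_
  refine (intrinsicEDist_le_eVariationOn (γ := f ∘ γ) (hf.continuous.comp_continuousOn hγ)
    (by simp [h0]) (by simp [h1]) (hXY.comp hX)).trans ?_
  exact (hf.lipschitzOnWith (s := univ)).comp_eVariationOn_le (mapsTo_univ _ _)

theorem intrinsicEDist_comm_le (X : Set E) (a b : E) :
    intrinsicEDist X b a ≤ intrinsicEDist X a b := by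
  refine le_iInf fun ⟨γ, hγ, h0, h1, hX⟩ => ?_
  have hm : MapsTo (fun t : ℝ => 1 - t) (Icc 0 1) (Icc 0 1) := fun t ht =>
    ⟨by linarith [ht.2], by linarith [ht.1]⟩
  refine (intrinsicEDist_le_eVariationOn (γ := γ ∘ fun t => 1 - t) (hγ.comp (by fun_prop) hm)
    (by simp [h1]) (by simp [h0]) (hX.comp hm)).trans ?_
  exact eVariationOn.comp_le_of_antitoneOn _ _ (fun x _ y _ h => by linarith) hm

theorem intrinsicEDist_le_of_segment_subset {X : Set E} {a b : E} (h : segment ℝ a b ⊆ X) :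
    intrinsicEDist X a b ≤ ENNReal.ofReal (dist a b) := by
  refine (intrinsicEDist_le_eVariationOn (γ := AffineMap.lineMap a b)
    (lipschitzWith_lineMap a b).continuous.continuousOn (by simp) (by simp) ?_).trans ?_
  · intro t ht
    apply h
    rw [segment_eq_image_lineMap]
    exact mem_image_of_mem _ ht
  · have h1 := ((lipschitzWith_lineMap (𝕜 := ℝ) a b).lipschitzOnWith
      (s := univ)).comp_eVariationOn_le (g := id) (mapsTo_univ _ (Icc 0 1))
    have h2 := (monotoneOn_id (α := ℝ) (s := Icc 0 1)).eVariationOn_eq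
      (a := 0) (b := 1) (by simp) (by simp)
    rw [inter_self] at h2
    refine h1.trans ((mul_le_mul_right h2.le _).trans ?_)
    rw [← edist_dist, edist_nndist]
    simp

theorem intrinsicEDist_triangle (X : Set E) (a b c : E) :
    intrinsicEDist X a c ≤ intrinsicEDist X a b + intrinsicEDist X b c := by
  refine ENNReal.le_iInf_add_iInf fun ⟨γ, hγ, h0, h1, hX⟩ ⟨δ, hδ, k0, k1, kX⟩ => ?_
  have hm : MapsTo (fun t : ℝ => 2 * t) (Icc 0 (1 / 2)) (Icc 0 1) := fun t ht =>
    ⟨by linarith [ht.1], by linarith [ht.2]⟩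
  have km : MapsTo (fun t : ℝ => 2 * t - 1) (Icc (1 / 2) 1) (Icc 0 1) := fun t ht =>
    ⟨by linarith [ht.1], by linarith [ht.2]⟩
  set σ : ℝ → E := fun t => if t ≤ 1 / 2 then γ (2 * t) else δ (2 * t - 1) with hσ
  have e1 : EqOn σ (γ ∘ fun t => 2 * t) (Icc 0 (1 / 2)) := fun t ht => by
    simp only [hσ, if_pos ht.2, Function.comp]
  have e2 : EqOn σ (δ ∘ fun t => 2 * t - 1) (Icc (1 / 2) 1) := fun t ht => by
    rcases ht.1.eq_or_lt with rfl | h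
    · norm_num [hσ, h1, k0]
    · simp only [hσ, if_neg h.not_ge, Function.comp]
  have hU : Icc (0 : ℝ) (1 / 2) ∪ Icc (1 / 2) 1 = Icc 0 1 :=
    Icc_union_Icc_eq_Icc (by norm_num) (by norm_num)
  have hσc : ContinuousOn σ (Icc 0 1) := by
    rw [← hU]
    exact ((hγ.comp (by fun_prop) hm).congr e1).union_of_isClosed
      ((hδ.comp (by fun_prop) km).congr e2) isClosed_Icc isClosed_Icc
  have hσX : MapsTo σ (Icc 0 1) X := by
    rw [← hU]
    exact ((hX.comp hm).congr e1.symm).union ((kX.comp km).congr e2.symm)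
  refine (intrinsicEDist_le_eVariationOn hσc (by simp [hσ, h0])
    (by norm_num [hσ, k1]) hσX).trans ?_
  have hadd := eVariationOn.Icc_add_Icc σ (s := univ) (a := 0) (b := 1 / 2) (c := 1)
    (by norm_num) (by norm_num) (mem_univ _)
  simp only [univ_inter] at hadd
  rw [← hadd, eVariationOn.eq_of_eqOn e1, eVariationOn.eq_of_eqOn e2]
  exact add_le_add
    (eVariationOn.comp_le_of_monotoneOn _ _ (fun x _ y _ h => by simpa using h) hm)
    (eVariationOn.comp_le_of_monotoneOn _ _ (fun x _ y _ h => by simpa using h) km)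

end Curves

section ConvexBodies

open scoped RealInnerProductSpace

variable {E : Type*} [NormedAddCommGroup E] [InnerProductSpace ℝ E]

/-- The nearest-point projection onto a convex body is `1`-Lipschitz, fixes the body, and maps the
complement of the interior to the boundary. -/
theorem exists_lipschitz_retraction {K : Set E} (hK : IsConvexBody K) :
    ∃ p : E → E, LipschitzWith 1 p ∧ (∀ x ∈ K, p x = x) ∧
      MapsTo p (interior K)ᶜ (frontier K) := by
  obtain ⟨hc, hconv, hint⟩ := hK
  have hex : ∀ x, ∃ y ∈ K, ∀ w ∈ K, ⟪x - y, w - y⟫ ≤ 0 := fun x => by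
    obtain ⟨y, hy, h⟩ := exists_norm_eq_iInf_of_complete_convex (hint.mono interior_subset)
      hc.isComplete hconv x
    exact ⟨y, hy, (norm_eq_iInf_iff_real_inner_le_zero hconv hy).1 h⟩
  choose p hpK hp using hex
  refine ⟨p, LipschitzWith.of_dist_le_mul fun x y => ?_, fun x hx => ?_, fun x hx => ?_⟩
  · have h1 := hp x _ (hpK y)
    have h2 := hp y _ (hpK x)
    have h3 : ‖p x - p y‖ * ‖p x - p y‖ ≤ ⟪x - y, p x - p y⟫ := by
      rw [← real_inner_self_eq_norm_mul_norm]
      have : ⟪x - y, p x - p y⟫ - ⟪p x - p y, p x - p y⟫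
          = -⟪x - p x, p y - p x⟫ - ⟪y - p y, p x - p y⟫ := by
        simp only [inner_sub_left, inner_sub_right]; ring
      linarith
    have h4 := h3.trans (real_inner_le_norm (x - y) (p x - p y))
    rw [NNReal.coe_one, one_mul, dist_eq_norm, dist_eq_norm]
    by_contra! h
    nlinarith [norm_nonneg (x - y), norm_nonneg (p x - p y)]
  · have := hp x x hx
    rw [real_inner_self_nonpos, sub_eq_zero] at this
    exact this.symm
  · refine ⟨subset_closure (hpK x), fun hpi => hx ?_⟩
    obtain ⟨r, hr, hball⟩ := Metric.isOpen_iff.1 isOpen_interior _ hpi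
    have hlim : Tendsto (fun t : ℝ => p x + t • (x - p x)) (nhdsWithin 0 (Ioi 0))
        (nhds (p x)) := by
      have : Continuous fun t : ℝ => p x + t • (x - p x) := by fun_prop
      simpa using (this.tendsto 0).mono_left nhdsWithin_le_nhds
    obtain ⟨t, ht, ht0⟩ := ((hlim.eventually (isOpen_interior.mem_nhds hpi)).and
      self_mem_nhdsWithin).exists
    have h := hp x _ (interior_subset ht)
    rw [add_sub_cancel_left, real_inner_smul_right] at h
    have h' : ⟪x - p x, x - p x⟫ ≤ 0 := by
      by_contra! hcon
      exact absurd h (not_le.2 (mul_pos ht0 hcon))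
    rw [real_inner_self_nonpos, sub_eq_zero] at h'
    rwa [h']

theorem intrinsicEDist_frontier_le {K : Set E} (hK : IsConvexBody K) {a b : E}
    (ha : a ∈ frontier K) (hb : b ∈ frontier K) :
    intrinsicEDist (frontier K) a b ≤ intrinsicEDist (interior K)ᶜ a b := by
  obtain ⟨p, hp, hfix, hmaps⟩ := exists_lipschitz_retraction hK
  have h := intrinsicEDist_map_le one_ne_zero hp hmaps a b
  rwa [hfix a (hK.1.isClosed.frontier_subset ha), hfix b (hK.1.isClosed.frontier_subset hb),
    ENNReal.coe_one, one_mul] at h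

theorem exists_unit_support [CompleteSpace E] {K : Set E} (hK : IsConvexBody K) {x : E}
    (hx : x ∉ interior K) : ∃ u : E, ‖u‖ = 1 ∧ ∀ y ∈ K, ⟪u, y⟫ ≤ ⟪u, x⟫ := by
  obtain ⟨hc, hconv, hint⟩ := hK
  obtain ⟨f, hf⟩ := geometric_hahn_banach_open_point hconv.interior isOpen_interior hx
  set v := (InnerProductSpace.toDual ℝ E).symm f with hv
  have hfv : ∀ y, ⟪v, y⟫ = f y := fun y => InnerProductSpace.toDual_symm_apply
  have hv0 : v ≠ 0 := by
    rintro h0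
    obtain ⟨y, hy⟩ := hint
    have := hf y hy
    simp [← hfv, h0] at this
  refine ⟨‖v‖⁻¹ • v, norm_smul_inv_norm hv0, fun y hy => ?_⟩
  rw [real_inner_smul_left, real_inner_smul_left, hfv, hfv]
  refine mul_le_mul_of_nonneg_left ?_ (by positivity)
  have hy' : y ∈ closure (interior K) := by
    rw [hconv.closure_interior_eq_closure_of_nonempty_interior hint]
    exact subset_closure hy
  exact closure_minimal (fun a ha => (hf a ha).le) (isClosed_le f.continuous continuous_const) hy'

theorem inner_self_smul_add {u : E} (hu : ‖u‖ = 1) (x : E) (t : ℝ) :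
    ⟪u, x + t • u⟫ = ⟪u, x⟫ + t := by
  simp [inner_add_right, real_inner_smul_right, hu]

theorem exists_pos_add_smul_mem {K : Set E} {x : E} (hx : x ∈ interior K) (u : E) :
    ∃ t : ℝ, 0 < t ∧ x + t • u ∈ K := by
  have hlim : Tendsto (fun t : ℝ => x + t • u) (nhdsWithin 0 (Ioi 0)) (nhds x) := by
    have : Continuous fun t : ℝ => x + t • u := by fun_prop
    simpa using (this.tendsto 0).mono_left nhdsWithin_le_nhds
  obtain ⟨t, ht, ht0⟩ := ((hlim.eventually (isOpen_interior.mem_nhds hx)).and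
    self_mem_nhdsWithin).exists
  exact ⟨t, ht0, interior_subset ht⟩

theorem inner_le_add_of_frontier_near {K K' : Set E} {ε c : ℝ} (hK' : IsCompact K')
    (hnear : ∀ x ∈ frontier K', ∃ y ∈ K, dist x y ≤ ε) {u : E} (hu : ‖u‖ = 1)
    (hc : ∀ y ∈ K, ⟪u, y⟫ ≤ c) {x : E} (hx : x ∈ K') : ⟪u, x⟫ ≤ c + ε := by
  obtain ⟨w, hw, hmax⟩ := hK'.exists_isMaxOn ⟨x, hx⟩
    (f := fun y => ⟪u, y⟫) (by fun_prop)
  have hwf : w ∈ frontier K' := by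
    refine ⟨subset_closure hw, fun hwi => ?_⟩
    obtain ⟨t, ht, hm⟩ := exists_pos_add_smul_mem hwi u
    have h : ⟪u, w + t • u⟫ ≤ ⟪u, w⟫ := hmax hm
    rw [inner_self_smul_add hu] at h
    linarith
  obtain ⟨y, hy, hd⟩ := hnear w hwf
  have h1 : ⟪u, x⟫ ≤ ⟪u, w⟫ := hmax hx
  have h2 := real_inner_le_norm u (w - y)
  rw [hu, one_mul, ← dist_eq_norm, inner_sub_right] at h2
  linarith [hc y hy]

theorem closedBall_subset_of_frontier_near [CompleteSpace E] {K K' : Set E} {ε r ρ : ℝ} {z : E}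
    (hK' : IsConvexBody K') (hK : IsCompact K) (hnear : ∀ x ∈ frontier K, ∃ y ∈ K', dist x y ≤ ε)
    (hr : 0 ≤ r) (hball : closedBall z r ⊆ K) (hρ : ε + ρ < r) : closedBall z ρ ⊆ K' := by
  intro w hw
  by_contra hwK
  obtain ⟨u, hu, hs⟩ := exists_unit_support hK' fun h => hwK (interior_subset h)
  have h1 := inner_le_add_of_frontier_near hK hnear hu hs (x := z + r • u)
    (hball (by simp [norm_smul, hu, abs_of_nonneg hr]))
  have h2 := real_inner_le_norm u (w - z)
  rw [hu, one_mul, ← dist_eq_norm, inner_sub_right] at h2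
  rw [inner_self_smul_add hu] at h1
  linarith [mem_closedBall.1 hw]

theorem notMem_interior_of_dist_dilation_le [CompleteSpace E] {K K' : Set E} {ε ρ η τ : ℝ}
    {z a x : E} (hK : IsConvexBody K) (hK' : IsCompact K')
    (hnear : ∀ x ∈ frontier K', ∃ y ∈ K, dist x y ≤ ε) (hρ : 0 ≤ ρ) (hη : 0 ≤ η)
    (hball : closedBall z ρ ⊆ K) (ha : a ∉ interior K) (hx : dist (a + η • (a - z)) x ≤ τ)
    (hετ : ε + τ ≤ η * ρ) : x ∉ interior K' := by
  intro hxi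
  obtain ⟨u, hu, hs⟩ := exists_unit_support hK ha
  obtain ⟨t, ht, hm⟩ := exists_pos_add_smul_mem hxi u
  have h1 := inner_le_add_of_frontier_near hK' hnear hu hs hm
  have h2 := real_inner_le_norm u (a + η • (a - z) - x)
  rw [hu, one_mul, ← dist_eq_norm, inner_sub_right, inner_add_right, real_inner_smul_right,
    inner_sub_right] at h2
  have h3 := hs (z + ρ • u) (hball (by simp [norm_smul, hu, abs_of_nonneg hρ]))
  rw [inner_self_smul_add hu] at h1 h3
  have h4 : η * ρ ≤ η * (⟪u, a⟫ - ⟪u, z⟫) := mul_le_mul_of_nonneg_left (by linarith) hη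
  linarith

theorem add_smul_sub_notMem_interior [CompleteSpace E] {K : Set E} {z a : E} {t : ℝ}
    (hK : IsConvexBody K) (hz : z ∈ K) (ha : a ∉ interior K) (ht : 0 ≤ t) :
    a + t • (a - z) ∉ interior K := by
  intro hi
  obtain ⟨u, hu, hs⟩ := exists_unit_support hK ha
  obtain ⟨s, hs0, hm⟩ := exists_pos_add_smul_mem hi u
  have h1 := hs _ hm
  have h2 := mul_nonneg ht (sub_nonneg.2 (hs z hz))
  rw [inner_self_smul_add hu, inner_add_right, real_inner_smul_right, inner_sub_right] at h1
  linarith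

theorem intrinsicEDist_dilation_le [CompleteSpace E] {K K' : Set E} {ε ρ η R : ℝ} {z a a' : E}
    (hK : IsConvexBody K) (hK' : IsConvexBody K')
    (hnear : ∀ x ∈ frontier K', ∃ y ∈ K, dist x y ≤ ε) (hρ : 0 ≤ ρ) (hη : 0 ≤ η)
    (hball : closedBall z ρ ⊆ K) (hz : z ∈ K') (ha : a ∈ frontier K) (ha' : a' ∈ frontier K')
    (haa' : dist a a' ≤ ε) (hε : ε + (1 + η) * ε ≤ η * ρ) (hR : dist a' z ≤ R) :
    intrinsicEDist (interior K')ᶜ a' (a + η • (a - z)) ≤ ENNReal.ofReal (η * (R + ρ)) := by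
  have hd : dist (a + η • (a - z)) (a' + η • (a' - z)) ≤ (1 + η) * ε := by
    rw [dist_eq_norm, show a + η • (a - z) - (a' + η • (a' - z)) = (1 + η) • (a - a') by module,
      norm_smul, ← dist_eq_norm, Real.norm_of_nonneg (by linarith)]
    exact mul_le_mul_of_nonneg_left haa' (by linarith)
  have hε0 : 0 ≤ ε := dist_nonneg.trans haa'
  have h1 : intrinsicEDist (interior K')ᶜ a' (a' + η • (a' - z)) ≤ ENNReal.ofReal (η * R) := by
    refine (intrinsicEDist_le_of_segment_subset ?_).trans (ENNReal.ofReal_le_ofReal ?_)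
    · rw [segment_eq_image']
      rintro _ ⟨t, ht, rfl⟩
      have : a' + t • (a' + η • (a' - z) - a') = a' + (t * η) • (a' - z) := by module
      simp only [this]
      exact add_smul_sub_notMem_interior hK' hz ha'.2 (mul_nonneg ht.1 hη)
    · rw [dist_self_add_right, norm_smul, Real.norm_of_nonneg hη, ← dist_eq_norm]
      exact mul_le_mul_of_nonneg_left hR hη
  have h2 : intrinsicEDist (interior K')ᶜ (a' + η • (a' - z)) (a + η • (a - z))
      ≤ ENNReal.ofReal (η * ρ) := by
    refine (intrinsicEDist_le_of_segment_subset ?_).trans (ENNReal.ofReal_le_ofReal ?_)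
    · intro x hx
      refine notMem_interior_of_dist_dilation_le hK hK'.1 hnear hρ hη hball ha.2 ?_ hε
      have := (convex_closedBall (a + η • (a - z)) ((1 + η) * ε)).segment_subset
        (mem_closedBall'.2 hd) (mem_closedBall_self (by positivity)) hx
      exact mem_closedBall'.1 this
    · rw [dist_comm]; linarith
  refine (intrinsicEDist_triangle _ _ (a' + η • (a' - z)) _).trans ((add_le_add h1 h2).trans ?_)
  rw [← ENNReal.ofReal_add (mul_nonneg hη (dist_nonneg.trans hR)) (mul_nonneg hη hρ), mul_add]

/-- Quantitative comparison of the intrinsic distances on two nearby convex surfaces. -/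
theorem intrinsicEDist_frontier_le_of_near [CompleteSpace E] {K K' : Set E} {ε ρ η R : ℝ}
    {z a a' b b' : E} (hK : IsConvexBody K) (hK' : IsConvexBody K')
    (hnear : ∀ x ∈ frontier K', ∃ y ∈ K, dist x y ≤ ε) (hρ : 0 ≤ ρ) (hη : 0 ≤ η)
    (hball : closedBall z ρ ⊆ K) (hz : z ∈ K') (ha : a ∈ frontier K) (ha' : a' ∈ frontier K')
    (hb : b ∈ frontier K) (hb' : b' ∈ frontier K') (haa' : dist a a' ≤ ε) (hbb' : dist b b' ≤ ε)
    (hε : ε + (1 + η) * ε ≤ η * ρ) (haR : dist a' z ≤ R) (hbR : dist b' z ≤ R) :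
    intrinsicEDist (frontier K') a' b' ≤
      ENNReal.ofReal (1 + η) * intrinsicEDist (frontier K) a b
        + ENNReal.ofReal (2 * (η * (R + ρ))) := by
  have hε0 : 0 ≤ ε := dist_nonneg.trans haa'
  have hA := intrinsicEDist_dilation_le hK hK' hnear hρ hη hball hz ha ha' haa' hε haR
  have hB := (intrinsicEDist_comm_le _ _ _).trans
    (intrinsicEDist_dilation_le hK hK' hnear hρ hη hball hz hb hb' hbb' hε hbR)
  have hlip : LipschitzWith (1 + η).toNNReal fun x : E => x + η • (x - z) := by
    refine LipschitzWith.of_dist_le_mul fun x y => ?_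
    rw [dist_eq_norm, show x + η • (x - z) - (y + η • (y - z)) = (1 + η) • (x - y) by module,
      norm_smul, ← dist_eq_norm, Real.norm_of_nonneg (by linarith),
      Real.coe_toNNReal _ (by linarith)]
  have hM := intrinsicEDist_map_le (X := frontier K) (Y := (interior K')ᶜ)
    (by rw [Ne, Real.toNNReal_eq_zero]; linarith) hlip (fun x hx =>
      notMem_interior_of_dist_dilation_le hK hK'.1 hnear hρ hη hball hx.2
        (dist_self _).le (by nlinarith)) a b
  refine (intrinsicEDist_frontier_le hK' ha' hb').trans ?_
  refine (intrinsicEDist_triangle _ _ (a + η • (a - z)) _).trans ?_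
  refine (add_le_add hA ((intrinsicEDist_triangle _ _ (b + η • (b - z)) _).trans
    (add_le_add hM hB))).trans_eq ?_
  have hnn : 0 ≤ η * (R + ρ) := mul_nonneg hη (add_nonneg (dist_nonneg.trans haR) hρ)
  rw [two_mul, ENNReal.ofReal_add hnn hnn, ENNReal.ofReal_eq_coe_nnreal (by linarith : 0 ≤ 1 + η),
    Real.toNNReal_of_nonneg (by linarith : 0 ≤ 1 + η)]
  ring

end ConvexBodies

theorem tendsto_toReal_of_eventually_le {d : ENNReal} {D : ℕ → ENNReal} {M : ℝ}
    (h : ∀ η : ℝ, 0 < η → ∀ᶠ k in atTop,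
      D k ≤ ENNReal.ofReal (1 + η) * d + ENNReal.ofReal (η * M) ∧
      d ≤ ENNReal.ofReal (1 + η) * D k + ENNReal.ofReal (η * M)) :
    Tendsto (fun k => (D k).toReal) atTop (nhds d.toReal) := by
  by_cases hd : d = ⊤
  · refine tendsto_const_nhds.congr' ?_
    filter_upwards [h 1 one_pos] with k hk
    have hk2 := hk.2
    have : D k = ⊤ := by
      by_contra hD
      rw [hd, top_le_iff] at hk2
      exact absurd hk2 (by finiteness)
    rw [hd, this]
  · rw [Metric.tendsto_atTop']
    intro δ hδ
    set e := d.toReal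
    have he : 0 ≤ e := ENNReal.toReal_nonneg
    set N := 2 * e + 2 * |M| + 1 with hN
    have hN0 : 0 < N := by positivity
    have hη : 0 < min 1 (δ / (2 * N)) := by positivity
    generalize hηdef : min 1 (δ / (2 * N)) = η at hη
    have hη1 : η ≤ 1 := hηdef ▸ min_le_left _ _
    have hη2 : η * N < δ := by
      have : η ≤ δ / (2 * N) := hηdef ▸ min_le_right _ _
      rw [le_div_iff₀ (by positivity)] at this
      linarith
    obtain ⟨n, hn⟩ := eventually_atTop.1 (h η hη)
    refine ⟨n, fun k hk => ?_⟩
    obtain ⟨h1, h2⟩ := hn k hk.le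
    have hD : D k ≠ ⊤ := ne_top_of_le_ne_top (by finiteness) h1
    have hM : (ENNReal.ofReal (η * M)).toReal ≤ η * |M| := by
      rw [ENNReal.toReal_ofReal']
      exact max_le (mul_le_mul_of_nonneg_left (le_abs_self M) hη.le) (by positivity)
    have h1' := ENNReal.toReal_mono (by finiteness) h1
    have h2' := ENNReal.toReal_mono (by finiteness) h2
    rw [ENNReal.toReal_add (by finiteness) (by finiteness), ENNReal.toReal_mul,
      ENNReal.toReal_ofReal (by linarith)] at h1' h2'
    have hf : 0 ≤ (D k).toReal := ENNReal.toReal_nonneg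
    have hf2 : (D k).toReal ≤ 2 * e + |M| := by nlinarith [abs_nonneg M]
    rw [Real.dist_eq, abs_lt]
    constructor <;> nlinarith [abs_nonneg M]

/-- Let `X` and `X_k` be convex surfaces in `ℝᵐ` with Hausdorff distance
of `X_k` to `X` tending to `0`. If `a, b ∈ X`, `a_k, b_k ∈ X_k`, `a_k → a`, `b_k → b`,
then the intrinsic distances `dist_{X_k}(a_k, b_k)` converge to `dist_X(a, b)`. -/
theorem intrinsicDist_tendsto_of_hausdorff (m : ℕ)
    (X : Set (EuclideanSpace ℝ (Fin m))) (hX : IsConvexSurface X)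
    (Xk : ℕ → Set (EuclideanSpace ℝ (Fin m))) (hXk : ∀ k, IsConvexSurface (Xk k))
    (hH : Tendsto (fun k => Metric.hausdorffDist (Xk k) X) atTop (nhds 0))
    (a b : EuclideanSpace ℝ (Fin m)) (ha : a ∈ X) (hb : b ∈ X)
    (ak bk : ℕ → EuclideanSpace ℝ (Fin m)) (hak : ∀ k, ak k ∈ Xk k) (hbk : ∀ k, bk k ∈ Xk k)
    (haconv : Tendsto ak atTop (nhds a)) (hbconv : Tendsto bk atTop (nhds b)) :
    Tendsto (fun k => intrinsicDist (Xk k) (ak k) (bk k)) atTop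
      (nhds (intrinsicDist X a b)) := by
  obtain ⟨C, hC, rfl⟩ := hX
  choose Ck hCk hXk using hXk
  obtain rfl : Xk = fun k => frontier (Ck k) := funext hXk
  obtain ⟨z, hz⟩ := hC.2.2
  obtain ⟨r, hr, hball⟩ := Metric.nhds_basis_closedBall.mem_iff.1 (mem_interior_iff_mem_nhds.1 hz)
  set R := max (dist a z) (dist b z) + 1 with hR
  simp only [intrinsicDist_eq_toReal]
  refine tendsto_toReal_of_eventually_le (M := 2 * (R + r / 2)) fun η hη => ?_
  obtain ⟨ε, hε, hε1, hεr, hεη⟩ : ∃ ε : ℝ, 0 < ε ∧ ε ≤ 1 ∧ ε < r / 2 ∧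
      ε + (1 + η) * ε ≤ η * (r / 2) := by
    refine ⟨min 1 (min (r / 4) (η * (r / 2) / (2 + η))), by positivity, min_le_left _ _, ?_, ?_⟩
    · exact ((min_le_right _ _).trans (min_le_left _ _)).trans_lt (by linarith)
    · have h := (min_le_right 1 (min (r / 4) (η * (r / 2) / (2 + η)))).trans (min_le_right _ _)
      rw [le_div_iff₀ (by positivity)] at h
      linarith
  filter_upwards [hH.eventually (gt_mem_nhds hε), haconv.eventually (closedBall_mem_nhds a hε),
    hbconv.eventually (closedBall_mem_nhds b hε)] with k hHk hak' hbk'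
  have hfin : hausdorffEDist (frontier (Ck k)) (frontier C) ≠ ⊤ :=
    hausdorffEDist_ne_top_of_nonempty_of_bounded ⟨_, hak k⟩ ⟨a, ha⟩
      ((hCk k).1.isBounded.subset (hCk k).1.isClosed.frontier_subset)
      (hC.1.isBounded.subset hC.1.isClosed.frontier_subset)
  have hn1 : ∀ x ∈ frontier (Ck k), ∃ y ∈ C, dist x y ≤ ε := fun x hx => by
    obtain ⟨y, hy, h⟩ := exists_dist_lt_of_hausdorffDist_lt hx hHk hfin
    exact ⟨y, hC.1.isClosed.frontier_subset hy, h.le⟩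
  have hn2 : ∀ x ∈ frontier C, ∃ y ∈ Ck k, dist x y ≤ ε := fun x hx => by
    obtain ⟨y, hy, h⟩ := exists_dist_lt_of_hausdorffDist_lt' hx hHk hfin
    exact ⟨y, (hCk k).1.isClosed.frontier_subset hy, by rw [dist_comm]; exact h.le⟩
  have hball1 : closedBall z (r / 2) ⊆ C := (closedBall_subset_closedBall (by linarith)).trans hball
  have hball2 : closedBall z (r / 2) ⊆ Ck k :=
    closedBall_subset_of_frontier_near (hCk k) hC.1 hn2 hr.le hball (by linarith)
  have hda : dist (ak k) a ≤ ε := hak'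
  have hdb : dist (bk k) b ≤ ε := hbk'
  have hra := le_max_left (dist a z) (dist b z)
  have hrb := le_max_right (dist a z) (dist b z)
  have hta := dist_triangle (ak k) a z
  have htb := dist_triangle (bk k) b z
  rw [mul_left_comm η 2]
  exact ⟨intrinsicEDist_frontier_le_of_near hC (hCk k) hn1 (by positivity) hη.le hball1
      (hball2 (mem_closedBall_self (by positivity))) ha (hak k) hb (hbk k)
      (by rwa [dist_comm]) (by rwa [dist_comm]) hεη (by linarith) (by linarith),
    intrinsicEDist_frontier_le_of_near (hCk k) hC hn2 (by positivity) hη.le hball2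
      (hball1 (mem_closedBall_self (by positivity))) (hak k) ha (hbk k) hb hda hdb hεη
      (by linarith) (by linarith)⟩
end

section
/- Let X and X_k (k ∈ ℕ) be convex surfaces in ℝ^m such that the Hausdorff distance between X_k and X tends to 0 as k → ∞. Then the intrinsic diameters converge: sup_{x,y ∈ X_k} dist_{X_k}(x,y) → sup_{x,y ∈ X} dist_X(x,y) as k → ∞, where dist_X and dist_{X_k} denote the intrinsic distances on X and X_k respectively. -/
open Set Filter Metric

/-- The intrinsic diameter of `X`: the supremum of intrinsic distances of pairs of points
of `X`. -/
noncomputable def intrinsicDiam {E : Type*} [NormedAddCommGroup E] [NormedSpace ℝ E]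
    (X : Set E) : ℝ :=
  sSup {d : ℝ | ∃ x ∈ X, ∃ y ∈ X, intrinsicDist X x y = d}

section Lipschitz

variable {E : Type*} [NormedAddCommGroup E] [NormedSpace ℝ E]

theorem intrinsicDiam_nonneg (X : Set E) : 0 ≤ intrinsicDiam X := by
  refine Real.sSup_nonneg ?_
  rintro _ ⟨x, _, y, _, rfl⟩
  exact ENNReal.toReal_nonneg

theorem intrinsicEDist_image_le {X Y : Set E} {f : E → E} {K : NNReal}
    (hK : K ≠ 0) (hf : LipschitzWith K f) (hXY : MapsTo f X Y) (a b : E) :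
    intrinsicEDist Y (f a) (f b) ≤ K * intrinsicEDist X a b := by
  unfold intrinsicEDist
  rw [ENNReal.mul_iInf_of_ne (ENNReal.coe_ne_zero.2 hK) ENNReal.coe_ne_top]
  refine le_iInf ?_
  rintro ⟨γ, h1, h2, h3, h4⟩
  exact (iInf_le _ ⟨f ∘ γ, hf.continuous.comp_continuousOn h1, congrArg f h2, congrArg f h3,
    hXY.comp h4⟩).trans ((hf.lipschitzOnWith (s := univ)).comp_eVariationOn_le (mapsTo_univ _ _))

/-- Pairs of points of `X` have uniformly bounded intrinsic distance. -/
def IntrinsicallyBounded (X : Set E) : Prop :=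
  ∃ M : NNReal, ∀ x ∈ X, ∀ y ∈ X, intrinsicEDist X x y ≤ M

theorem IntrinsicallyBounded.of_surjOn {X Y : Set E} {f : E → E} {K : NNReal}
    (hX : IntrinsicallyBounded X) (hK : K ≠ 0) (hf : LipschitzWith K f) (hXY : MapsTo f X Y)
    (hs : SurjOn f X Y) : IntrinsicallyBounded Y := by
  obtain ⟨M, hM⟩ := hX
  refine ⟨K * M, fun x hx y hy => ?_⟩
  obtain ⟨a, ha, rfl⟩ := hs hx
  obtain ⟨b, hb, rfl⟩ := hs hy
  push_cast
  exact (intrinsicEDist_image_le hK hf hXY a b).trans (by gcongr; exact hM a ha b hb)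

theorem IntrinsicallyBounded.intrinsicDist_le {X : Set E} (hX : IntrinsicallyBounded X)
    {x y : E} (hx : x ∈ X) (hy : y ∈ X) : intrinsicDist X x y ≤ intrinsicDiam X := by
  obtain ⟨M, hM⟩ := hX
  refine le_csSup ⟨M, ?_⟩ ⟨x, hx, y, hy, rfl⟩
  rintro _ ⟨a, ha, b, hb, rfl⟩
  exact ENNReal.toReal_le_coe_of_le_coe (hM a ha b hb)

theorem intrinsicDiam_le_of_surjOn {X Y : Set E} {f : E → E} {K : NNReal}
    (hX : IntrinsicallyBounded X) (hK : K ≠ 0) (hf : LipschitzWith K f) (hXY : MapsTo f X Y)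
    (hs : SurjOn f X Y) : intrinsicDiam Y ≤ K * intrinsicDiam X := by
  refine Real.sSup_le ?_ (mul_nonneg K.2 (intrinsicDiam_nonneg X))
  rintro _ ⟨x, hx, y, hy, rfl⟩
  obtain ⟨a, ha, rfl⟩ := hs hx
  obtain ⟨b, hb, rfl⟩ := hs hy
  refine le_trans ?_ (mul_le_mul_of_nonneg_left (hX.intrinsicDist_le ha hb) K.2)
  obtain ⟨M, hM⟩ := hX
  have h := ENNReal.toReal_mono (ENNReal.mul_ne_top ENNReal.coe_ne_top
    (ne_top_of_le_ne_top ENNReal.coe_ne_top (hM a ha b hb))) (intrinsicEDist_image_le hK hf hXY a b)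
  rwa [ENNReal.toReal_mul] at h

/-- The homothety of center `c` and ratio `l ≠ 0`, as a homeomorphism. -/
noncomputable def homothetyHomeomorph (c : E) {l : ℝ} (hl : l ≠ 0) : E ≃ₜ E :=
  ((Homeomorph.subRight c).trans (Homeomorph.smulOfNeZero l hl)).trans (Homeomorph.addRight c)

theorem homothetyHomeomorph_apply (c : E) {l : ℝ} (hl : l ≠ 0) (x : E) :
    homothetyHomeomorph c hl x = l • (x - c) + c := rfl

theorem lipschitzWith_homothetyHomeomorph (c : E) {l : ℝ} (hl : l ≠ 0) :
    LipschitzWith ‖l‖₊ (homothetyHomeomorph c hl) := by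
  refine LipschitzWith.of_dist_le_mul fun x y => ?_
  simp only [homothetyHomeomorph_apply, dist_add_right, dist_smul₀, dist_sub_right, coe_nnnorm,
    le_refl]

theorem homothetyHomeomorph_symm (c : E) {l : ℝ} (hl : l ≠ 0) :
    (homothetyHomeomorph c hl).symm = homothetyHomeomorph c (inv_ne_zero hl) := by
  ext x
  rw [Homeomorph.symm_apply_eq]
  simp [homothetyHomeomorph_apply, hl]

theorem IsConvexBody.image_homothety {C : Set E} (hC : IsConvexBody C) (c : E) {l : ℝ}
    (hl : l ≠ 0) : IsConvexBody (homothetyHomeomorph c hl '' C) := by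
  refine ⟨hC.1.image (homothetyHomeomorph c hl).continuous, ?_, ?_⟩
  · have : (homothetyHomeomorph c hl : E → E) = AffineMap.homothety c l := by
      ext x
      simp [homothetyHomeomorph_apply, AffineMap.homothety_apply]
    rw [this]
    exact hC.2.1.affine_image _
  · rw [← (homothetyHomeomorph c hl).image_interior]
    exact hC.2.2.image _

theorem intrinsicDiam_frontier_homothety_le {C : Set E} (hC : IntrinsicallyBounded (frontier C))
    (c : E) {l : ℝ} (hl : 0 < l) :
    intrinsicDiam (frontier (homothetyHomeomorph c hl.ne' '' C)) ≤
      l * intrinsicDiam (frontier C) := by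
  rw [← Homeomorph.image_frontier]
  have := intrinsicDiam_le_of_surjOn hC (nnnorm_ne_zero_iff.2 hl.ne')
    (lipschitzWith_homothetyHomeomorph c hl.ne')
    (mapsTo_image _ _) (surjOn_image _ _)
  rwa [coe_nnnorm, Real.norm_of_nonneg hl.le] at this

theorem IntrinsicallyBounded.frontier_homothety {C : Set E}
    (hC : IntrinsicallyBounded (frontier C)) (c : E) {l : ℝ} (hl : l ≠ 0) :
    IntrinsicallyBounded (frontier (homothetyHomeomorph c hl '' C)) := by
  rw [← Homeomorph.image_frontier]
  exact hC.of_surjOn (nnnorm_ne_zero_iff.2 hl) (lipschitzWith_homothetyHomeomorph c hl)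
    (mapsTo_image _ _) (surjOn_image _ _)

end Lipschitz

section Projection

variable {E : Type*} [NormedAddCommGroup E] [InnerProductSpace ℝ E]

/-- The nearest-point projection of `u` onto a convex body, through its variational
characterization. -/
theorem IsConvexBody.exists_proj {K : Set E} (hK : IsConvexBody K) (u : E) :
    ∃ v ∈ K, ∀ w ∈ K, inner ℝ (u - v) (w - v) ≤ 0 := by
  obtain ⟨v, hv, h⟩ := exists_norm_eq_iInf_of_complete_convex
    (hK.2.2.mono interior_subset) hK.1.isComplete hK.2.1 u
  exact ⟨v, hv, (norm_eq_iInf_iff_real_inner_le_zero hK.2.1 hv).1 h⟩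

theorem norm_sub_le_of_inner_nonpos {u v u' v' : E} (h : inner ℝ (u - v) (v' - v) ≤ 0)
    (h' : inner ℝ (u' - v') (v - v') ≤ 0) : ‖v - v'‖ ≤ ‖u - u'‖ := by
  have h1 : ‖v - v'‖ * ‖v - v'‖ ≤ ‖u - u'‖ * ‖v - v'‖ := by
    refine le_trans ?_ (real_inner_le_norm (u - u') (v - v'))
    rw [← real_inner_self_eq_norm_mul_norm]
    have e : inner ℝ (u - u') (v - v') = inner ℝ (v - v') (v - v')
        - inner ℝ (u - v) (v' - v) - inner ℝ (u' - v') (v - v') := by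
      simp only [inner_sub_left, inner_sub_right]
      ring
    linarith
  rcases (norm_nonneg (v - v')).eq_or_lt with h0 | h0
  · rw [← h0]; exact norm_nonneg _
  · exact le_of_mul_le_mul_right h1 h0

/-- A functional attaining its maximum over `K` at an interior point vanishes. -/
theorem eq_zero_of_inner_nonpos_of_mem_interior {K : Set E} {v u : E} (hv : v ∈ interior K)
    (h : ∀ w ∈ K, inner ℝ u (w - v) ≤ 0) : u = 0 := by
  obtain ⟨r, hr, hrK⟩ := Metric.mem_nhds_iff.1 (mem_interior_iff_mem_nhds.1 hv)
  by_contra hu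
  have hu' : 0 < ‖u‖ := norm_pos_iff.2 hu
  have hm : v + (r / 2 / ‖u‖) • u ∈ K := by
    apply hrK
    rw [mem_ball, dist_eq_norm, add_sub_cancel_left, norm_smul, Real.norm_of_nonneg (by positivity),
      div_mul_cancel₀ _ hu'.ne']
    linarith
  have := h _ hm
  rw [add_sub_cancel_left, inner_smul_right, real_inner_self_eq_norm_sq] at this
  have : 0 < r / 2 / ‖u‖ * ‖u‖ ^ 2 := by positivity
  linarith

theorem IsConvexBody.exists_supporting [CompleteSpace E] {K : Set E} (hK : IsConvexBody K) {x : E}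
    (hx : x ∈ frontier K) : ∃ u : E, u ≠ 0 ∧ ∀ w ∈ K, inner ℝ u (w - x) ≤ 0 := by
  obtain ⟨f, hf⟩ := geometric_hahn_banach_open_point hK.2.1.interior isOpen_interior hx.2
  refine ⟨(InnerProductSpace.toDual ℝ E).symm f, ?_, fun w hw => ?_⟩
  · obtain ⟨a, ha⟩ := hK.2.2
    intro h0
    rw [LinearIsometryEquiv.map_eq_zero_iff] at h0
    simpa [h0] using hf a ha
  · rw [InnerProductSpace.toDual_symm_apply, map_sub, sub_nonpos]
    have hw' : w ∈ closure (interior K) := by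
      rw [hK.2.1.closure_interior_eq_closure_of_nonempty_interior hK.2.2]
      exact subset_closure hw
    exact closure_minimal (fun a ha => (hf a ha).le) (isClosed_le f.continuous continuous_const) hw'

theorem exists_nonneg_add_smul_mem_frontier {K : Set E} (hK : IsCompact K) {x u : E} (hx : x ∈ K)
    (hu : u ≠ 0) : ∃ t : ℝ, 0 ≤ t ∧ x + t • u ∈ frontier K := by
  have hg : Continuous fun t : ℝ => x + t • u := by fun_prop
  set S := (fun t : ℝ => x + t • u) ⁻¹' K with hS
  have h0 : (0 : ℝ) ∈ S := by simpa [hS] using hx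
  have hb : BddAbove S := by
    obtain ⟨R, hR⟩ := hK.isBounded.subset_closedBall x
    refine ⟨R / ‖u‖, fun t ht => ?_⟩
    have := hR ht
    rw [mem_closedBall, dist_eq_norm, add_sub_cancel_left, norm_smul] at this
    rw [le_div_iff₀ (norm_pos_iff.2 hu)]
    exact le_trans (by gcongr; exact le_abs_self t) this
  have hm : sSup S ∈ S := (hK.isClosed.preimage hg).csSup_mem ⟨0, h0⟩ hb
  refine ⟨sSup S, le_csSup hb h0, hg.frontier_preimage_subset K ⟨subset_closure hm, fun hi => ?_⟩⟩
  obtain ⟨r, hr, hrS⟩ := Metric.mem_nhds_iff.1 (mem_interior_iff_mem_nhds.1 hi)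
  have : sSup S + r / 2 ∈ S := hrS (by
    rw [mem_ball, Real.dist_eq, add_sub_cancel_left, abs_of_pos (by positivity)]; linarith)
  linarith [le_csSup hb this]

/-- The nearest-point projection onto a convex body maps the boundary of any larger convex body
onto its boundary without increasing distances. -/
theorem IsConvexBody.exists_lipschitz_surjOn [CompleteSpace E] {K L : Set E}
    (hK : IsConvexBody K) (hL : IsConvexBody L) (hKL : K ⊆ L) :
    ∃ P : E → E, LipschitzWith 1 P ∧ MapsTo P (frontier L) (frontier K) ∧
      SurjOn P (frontier L) (frontier K) := by
  choose P hP hP' using hK.exists_proj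
  refine ⟨P, LipschitzWith.mk_one fun x y => ?_, fun x hx => ⟨subset_closure (hP x), fun hi => ?_⟩,
    fun x hx => ?_⟩
  · simpa only [dist_eq_norm] using norm_sub_le_of_inner_nonpos (hP' x _ (hP y)) (hP' y _ (hP x))
  · have h0 := eq_zero_of_inner_nonpos_of_mem_interior hi (hP' x)
    rw [← sub_eq_zero.1 h0] at hi
    exact hx.2 (interior_mono hKL hi)
  · have hxK : x ∈ K := hK.1.isClosed.frontier_subset hx
    obtain ⟨u, hu, hu'⟩ := hK.exists_supporting hx
    obtain ⟨t, ht, htL⟩ := exists_nonneg_add_smul_mem_frontier hL.1 (hKL hxK) hu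
    refine ⟨_, htL, ?_⟩
    have := norm_sub_le_of_inner_nonpos (hP' (x + t • u) _ hxK) (u' := x + t • u) (v' := x) (by
      rw [add_sub_cancel_left, real_inner_smul_left]
      exact mul_nonpos_of_nonneg_of_nonpos ht (hu' _ (hP _)))
    rw [sub_self, norm_zero, norm_le_zero_iff] at this
    exact sub_eq_zero.1 this

theorem IsConvexBody.intrinsicDiam_frontier_mono [CompleteSpace E] {K L : Set E}
    (hK : IsConvexBody K) (hL : IsConvexBody L) (hKL : K ⊆ L)
    (hb : IntrinsicallyBounded (frontier L)) :
    intrinsicDiam (frontier K) ≤ intrinsicDiam (frontier L) := by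
  obtain ⟨P, h1, h2, h3⟩ := hK.exists_lipschitz_surjOn hL hKL
  simpa using intrinsicDiam_le_of_surjOn hb one_ne_zero h1 h2 h3

/-- Cancellation of a ball: if every point of `L` is within `δ` of `K` and the `δ`-ball around `z`
lies in `L`, then `z` lies in `K`. -/
theorem IsConvexBody.mem_of_closedBall_subset {K L : Set E} (hK : IsConvexBody K) {δ : ℝ}
    (hδ : 0 ≤ δ) (hLK : ∀ y ∈ L, ∃ w ∈ K, ‖y - w‖ ≤ δ) {z : E} (hz : closedBall z δ ⊆ L) :
    z ∈ K := by
  obtain ⟨p, hp, hp'⟩ := hK.exists_proj z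
  by_contra hzK
  have hne : z - p ≠ 0 := fun h => hzK (by rwa [sub_eq_zero.1 h])
  have hpos : 0 < ‖z - p‖ := norm_pos_iff.2 hne
  obtain ⟨w, hw, hwδ⟩ := hLK (z + (δ / ‖z - p‖) • (z - p)) (hz (by
    rw [mem_closedBall, dist_eq_norm, add_sub_cancel_left, norm_smul,
      Real.norm_of_nonneg (by positivity), div_mul_cancel₀ _ hpos.ne']))
  have h1 := real_inner_le_norm (z - p) (z + (δ / ‖z - p‖) • (z - p) - w)
  have e : inner ℝ (z - p) (z + (δ / ‖z - p‖) • (z - p) - w) =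
      (1 + δ / ‖z - p‖) * inner ℝ (z - p) (z - p) - inner ℝ (z - p) (w - p) := by
    have : z + (δ / ‖z - p‖) • (z - p) - w = (1 + δ / ‖z - p‖) • (z - p) - (w - p) := by module
    rw [this, inner_sub_right, real_inner_smul_right]
  have h2 : (1 + δ / ‖z - p‖) * (‖z - p‖ * ‖z - p‖) = ‖z - p‖ * ‖z - p‖ + ‖z - p‖ * δ := by
    field_simp
  rw [e, real_inner_self_eq_norm_mul_norm, h2] at h1
  have h3 := mul_le_mul_of_nonneg_left hwδ hpos.le
  have h4 := hp' w hw
  have : 0 < ‖z - p‖ * ‖z - p‖ := by positivity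
  linarith

end Projection

section Hausdorff

variable {E : Type*} [NormedAddCommGroup E] [NormedSpace ℝ E]

theorem IsConvexBody.subset_closure_convexHull_frontier [Nontrivial E] {C : Set E}
    (hC : IsConvexBody C) : C ⊆ closure (convexHull ℝ (frontier C)) := by
  rw [← closure_convexHull_extremePoints hC.1 hC.2.1]
  refine closure_mono (convexHull_mono fun x hx => ⟨subset_closure ?_, fun hi => ?_⟩)
  · rw [closure_convexHull_extremePoints hC.1 hC.2.1]
    exact hx.1
  · rw [closure_convexHull_extremePoints hC.1 hC.2.1] at hi
    exact (disjoint_interior_extremePoints C).le_bot ⟨hi, hx⟩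

theorem IsConvexBody.frontier_nonempty [Nontrivial E] {C : Set E}
    (hC : IsConvexBody C) : (frontier C).Nonempty := by
  obtain ⟨x, hx⟩ := hC.2.2
  have := closure_nonempty_iff.1 ⟨x, hC.subset_closure_convexHull_frontier (interior_subset hx)⟩
  exact convexHull_nonempty_iff.1 this

theorem IsConvexBody.exists_norm_sub_le_hausdorffDist [Nontrivial E] {C D : Set E}
    (hC : IsConvexBody C) (hD : IsConvexBody D) {x : E} (hx : x ∈ C) :
    ∃ y ∈ D, ‖x - y‖ ≤ hausdorffDist (frontier C) (frontier D) := by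
  have hfin : hausdorffEDist (frontier C) (frontier D) ≠ ⊤ :=
    hausdorffEDist_ne_top_of_nonempty_of_bounded hC.frontier_nonempty hD.frontier_nonempty
      (hC.1.isBounded.subset hC.1.isClosed.frontier_subset)
      (hD.1.isBounded.subset hD.1.isClosed.frontier_subset)
  have hsub : frontier C ⊆ cthickening (hausdorffDist (frontier C) (frontier D)) D := by
    intro z hz
    refine cthickening_subset_of_subset _ hD.1.isClosed.frontier_subset ?_
    rw [mem_cthickening_iff, ENNReal.le_ofReal_iff_toReal_le
      (infEDist_ne_top hD.frontier_nonempty) hausdorffDist_nonneg]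
    exact infDist_le_hausdorffDist_of_mem hz hfin
  have := closure_minimal (convexHull_min hsub (hD.2.1.cthickening _)) isClosed_cthickening
    (hC.subset_closure_convexHull_frontier hx)
  rw [hD.1.cthickening_eq_biUnion_closedBall hausdorffDist_nonneg] at this
  simpa [dist_eq_norm] using this

theorem subset_image_homothety {C D : Set E} (hC : Convex ℝ C) {c : E} {r ε : ℝ} (hr : 0 < r)
    (hε : 0 ≤ ε) (hrC : closedBall c r ⊆ C) (h : ∀ x ∈ D, ∃ y ∈ C, ‖x - y‖ ≤ ε * r) :
    D ⊆ homothetyHomeomorph c (show 1 + ε ≠ 0 by positivity) '' C := by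
  intro x hx
  obtain ⟨y, hy, hxy⟩ := h x hx
  have hε1 : 1 + ε ≠ 0 := by positivity
  have hw : c + ε⁻¹ • (x - y) ∈ C := hrC (by
    rw [mem_closedBall, dist_eq_norm, add_sub_cancel_left, norm_smul, norm_inv,
      Real.norm_of_nonneg hε]
    exact inv_mul_le_of_le_mul₀ hε hr.le hxy)
  have he : ε • ε⁻¹ • (x - y) = x - y := by
    rcases hε.eq_or_lt with rfl | h0
    · simp only [zero_mul, norm_le_zero_iff] at hxy
      simp [hxy]
    · rw [smul_inv_smul₀ h0.ne']
  refine ⟨(1 / (1 + ε)) • y + (ε / (1 + ε)) • (c + ε⁻¹ • (x - y)),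
    hC hy hw (by positivity) (by positivity) (by field_simp), ?_⟩
  have e : (ε / (1 + ε)) • (c + ε⁻¹ • (x - y)) = (1 / (1 + ε)) • (ε • c + (x - y)) := by
    rw [div_eq_inv_mul, mul_smul, smul_add, he, one_div]
  rw [homothetyHomeomorph_apply, e, ← smul_add, smul_sub, smul_smul, mul_one_div_cancel hε1]
  module

theorem closedBall_homothety_subset {C : Set E} (hC : Convex ℝ C) {c : E} {r ε : ℝ}
    (hε : 0 ≤ ε) (hε1 : ε < 1) (hr : 0 < r) (hrC : closedBall c r ⊆ C) {y : E} (hy : y ∈ C) :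
    closedBall ((1 - ε) • (y - c) + c) (ε * r) ⊆ C := by
  intro x hx
  rw [mem_closedBall, dist_eq_norm] at hx
  set b := x - ((1 - ε) • (y - c) + c) with hb
  have he : ε • ε⁻¹ • b = b := by
    rcases hε.eq_or_lt with rfl | h0
    · simp only [zero_mul, norm_le_zero_iff] at hx
      simp [hx]
    · rw [smul_inv_smul₀ h0.ne']
  have hw : c + ε⁻¹ • b ∈ C := hrC (by
    rw [mem_closedBall, dist_eq_norm, add_sub_cancel_left, norm_smul, norm_inv,
      Real.norm_of_nonneg hε]
    exact inv_mul_le_of_le_mul₀ hε hr.le hx)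
  have := hC hy hw (sub_nonneg.2 hε1.le) hε (by ring)
  convert this using 1
  rw [smul_add, he, hb]
  module

end Hausdorff

section Bounded

variable {E : Type*} [NormedAddCommGroup E] [InnerProductSpace ℝ E]

theorem exists_norm_eq_inner_eq_zero [FiniteDimensional ℝ E] (hE : 1 < Module.finrank ℝ E) (a : E)
    {R : ℝ} (hR : 0 ≤ R) : ∃ v : E, ‖v‖ = R ∧ inner ℝ a v = 0 := by
  have : (ℝ ∙ a)ᗮ ≠ ⊥ := by
    intro h
    rw [Submodule.orthogonal_eq_bot_iff] at h
    have h1 := finrank_span_le_card (R := ℝ) ({a} : Set E)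
    rw [h, finrank_top] at h1
    simp only [toFinset_singleton, Finset.card_singleton] at h1
    omega
  obtain ⟨w, hw, hw0⟩ := Submodule.exists_mem_ne_zero_of_ne_bot this
  have hw0' : ‖w‖ ≠ 0 := norm_ne_zero_iff.2 hw0
  refine ⟨(R / ‖w‖) • w, ?_, ?_⟩
  · rw [norm_smul, Real.norm_of_nonneg (by positivity), div_mul_cancel₀ _ hw0']
  · rw [inner_smul_right, Submodule.mem_orthogonal_singleton_iff_inner_right.1 hw, mul_zero]

/-- Two points of a sphere centered at the origin lie on a common great circle. -/
theorem exists_eq_cos_smul_add_sin_smul [FiniteDimensional ℝ E] (hE : 1 < Module.finrank ℝ E)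
    {a b : E} {R : ℝ} (hR : 0 < R) (ha : ‖a‖ = R) (hb : ‖b‖ = R) :
    ∃ (v : E) (θ : ℝ), 0 ≤ θ ∧ θ ≤ Real.pi ∧ ‖v‖ = R ∧ inner ℝ a v = 0 ∧
      b = Real.cos θ • a + Real.sin θ • v := by
  set θ := InnerProductGeometry.angle a b with hθ
  have hc : Real.cos θ * (R * R) = inner ℝ a b := by
    have := InnerProductGeometry.cos_angle_mul_norm_mul_norm a b
    rwa [ha, hb] at this
  have haa : inner ℝ a a = R * R := by rw [real_inner_self_eq_norm_mul_norm, ha]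
  have hbb : inner ℝ b b = R * R := by rw [real_inner_self_eq_norm_mul_norm, hb]
  have hw : ‖b - Real.cos θ • a‖ = Real.sin θ * R := by
    rw [← sq_eq_sq₀ (norm_nonneg _) (mul_nonneg (InnerProductGeometry.sin_angle_nonneg a b) hR.le),
      ← real_inner_self_eq_norm_sq]
    simp only [inner_sub_left, inner_sub_right, real_inner_smul_left, real_inner_smul_right, haa,
      hbb, real_inner_comm a b, ← hc]
    rw [mul_pow, Real.sin_sq]
    ring
  rcases eq_or_ne (Real.sin θ) 0 with hs | hs
  · obtain ⟨v, hv, hav⟩ := exists_norm_eq_inner_eq_zero hE a hR.le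
    refine ⟨v, θ, InnerProductGeometry.angle_nonneg a b, InnerProductGeometry.angle_le_pi a b,
      hv, hav, ?_⟩
    rw [hs, zero_mul, norm_eq_zero, sub_eq_zero] at hw
    rw [hs, zero_smul, add_zero, ← hw]
  · refine ⟨(Real.sin θ)⁻¹ • (b - Real.cos θ • a), θ, InnerProductGeometry.angle_nonneg a b,
      InnerProductGeometry.angle_le_pi a b, ?_, ?_, ?_⟩
    · rw [norm_smul, hw, norm_inv, Real.norm_of_nonneg (InnerProductGeometry.sin_angle_nonneg a b),
        inv_mul_cancel_left₀ hs]
    · rw [inner_smul_right, inner_sub_right, inner_smul_right, haa, hc, sub_self, mul_zero]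
    · rw [smul_inv_smul₀ hs, add_sub_cancel]

theorem intrinsicallyBounded_sphere [FiniteDimensional ℝ E] (hE : 1 < Module.finrank ℝ E) (c : E)
    {R : ℝ} (hR : 0 < R) : IntrinsicallyBounded (sphere c R) := by
  refine ⟨Real.toNNReal (2 * Real.pi * R), fun x hx y hy => ?_⟩
  rw [mem_sphere, dist_eq_norm] at hx hy
  obtain ⟨v, θ, hθ0, hθ, hv, hav, hb⟩ := exists_eq_cos_smul_add_sin_smul hE hR hx hy
  set γ : ℝ → E := fun t => c + (Real.cos (t * θ) • (x - c) + Real.sin (t * θ) • v) with hγ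
  have hlip : LipschitzWith (Real.toNNReal (2 * Real.pi * R)) γ := by
    refine LipschitzWith.of_dist_le_mul fun s t => ?_
    have e : γ s - γ t = (Real.cos (s * θ) - Real.cos (t * θ)) • (x - c) +
        (Real.sin (s * θ) - Real.sin (t * θ)) • v := by
      simp only [hγ]
      module
    have h1 : |Real.cos (s * θ) - Real.cos (t * θ)| ≤ |s * θ - t * θ| :=
      Real.abs_cos_sub_cos_le _ _
    have h2 : |Real.sin (s * θ) - Real.sin (t * θ)| ≤ |s * θ - t * θ| :=
      Real.abs_sin_sub_sin_le _ _
    have h3 : |s * θ - t * θ| ≤ Real.pi * |s - t| := by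
      rw [← sub_mul, abs_mul, abs_of_nonneg hθ0, mul_comm]
      gcongr
    rw [Real.coe_toNNReal _ (by positivity), dist_eq_norm, e, Real.dist_eq]
    refine (norm_add_le _ _).trans ?_
    rw [norm_smul, norm_smul, hx, hv, Real.norm_eq_abs, Real.norm_eq_abs]
    have h4 := mul_le_mul_of_nonneg_right (h1.trans h3) hR.le
    have h5 := mul_le_mul_of_nonneg_right (h2.trans h3) hR.le
    linarith
  have hmaps : MapsTo γ (Icc 0 1) (sphere c R) := fun t _ => by
    rw [mem_sphere, dist_eq_norm, hγ, add_sub_cancel_left,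
      ← sq_eq_sq₀ (norm_nonneg _) hR.le, ← real_inner_self_eq_norm_sq]
    have haa : inner ℝ (x - c) (x - c) = R ^ 2 := by rw [real_inner_self_eq_norm_sq, hx]
    have hvv : inner ℝ v v = R ^ 2 := by rw [real_inner_self_eq_norm_sq, hv]
    have hva : inner ℝ v (x - c) = 0 := by rw [real_inner_comm, hav]
    simp only [inner_add_left, inner_add_right, real_inner_smul_left, real_inner_smul_right, haa,
      hvv, hav, hva]
    linear_combination R ^ 2 * Real.sin_sq_add_cos_sq (t * θ)
  have h1 : γ 1 = y := by
    simp only [hγ, one_mul]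
    rw [← hb, add_sub_cancel]
  refine (iInf_le _ ⟨γ, hlip.continuous.continuousOn, by simp [hγ], h1, hmaps⟩).trans ?_
  have hid : eVariationOn (id : ℝ → ℝ) (Icc 0 1) ≤ 1 := by
    simpa only [inter_self, id, sub_zero, ENNReal.ofReal_one] using
      ((monotone_id (α := ℝ)).monotoneOn (Icc 0 1)).eVariationOn_eq
      (left_mem_Icc.2 zero_le_one) (right_mem_Icc.2 zero_le_one) |>.le
  calc eVariationOn (γ ∘ id) (Icc 0 1)
      ≤ Real.toNNReal (2 * Real.pi * R) * eVariationOn (id : ℝ → ℝ) (Icc 0 1) :=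
        (hlip.lipschitzOnWith (s := univ)).comp_eVariationOn_le (mapsTo_univ _ _)
    _ ≤ Real.toNNReal (2 * Real.pi * R) * 1 := by gcongr
    _ = _ := mul_one _

theorem IsConvexBody.intrinsicallyBounded_frontier [FiniteDimensional ℝ E]
    (hE : 1 < Module.finrank ℝ E) {C : Set E} (hC : IsConvexBody C) :
    IntrinsicallyBounded (frontier C) := by
  obtain ⟨R, hR, hCR⟩ := hC.1.isBounded.subset_closedBall_lt 0 0
  have hB : IsConvexBody (closedBall (0 : E) R) :=
    ⟨isCompact_closedBall 0 R, convex_closedBall 0 R,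
      ⟨0, ball_subset_interior_closedBall (mem_ball_self hR)⟩⟩
  obtain ⟨P, h1, h2, h3⟩ := hC.exists_lipschitz_surjOn hB hCR
  refine IntrinsicallyBounded.of_surjOn ?_ one_ne_zero h1 h2 h3
  rw [frontier_closedBall _ hR.ne']
  exact intrinsicallyBounded_sphere hE 0 hR

end Bounded

theorem IsConvexBody.intrinsicDiam_frontier_bounds {E : Type*} [NormedAddCommGroup E]
    [InnerProductSpace ℝ E] [FiniteDimensional ℝ E] (hE : 1 < Module.finrank ℝ E) {C D : Set E}
    (hC : IsConvexBody C) (hD : IsConvexBody D) {c : E} {r : ℝ} (hr : 0 < r)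
    (hrC : closedBall c r ⊆ C) (hlt : hausdorffDist (frontier D) (frontier C) / r < 1) :
    (1 - hausdorffDist (frontier D) (frontier C) / r) * intrinsicDiam (frontier C) ≤
        intrinsicDiam (frontier D) ∧
      intrinsicDiam (frontier D) ≤
        (1 + hausdorffDist (frontier D) (frontier C) / r) * intrinsicDiam (frontier C) := by
  have : Nontrivial E := Module.nontrivial_of_finrank_pos (R := ℝ) (by omega)
  set ε := hausdorffDist (frontier D) (frontier C) / r with hε
  have hε0 : 0 ≤ ε := div_nonneg hausdorffDist_nonneg hr.le
  have hεr : ε * r = hausdorffDist (frontier D) (frontier C) := div_mul_cancel₀ _ hr.ne'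
  have hbC := hC.intrinsicallyBounded_frontier hE
  have hbD := hD.intrinsicallyBounded_frontier hE
  constructor
  · have hl : 0 < 1 - ε := sub_pos.2 hlt
    have hsub : homothetyHomeomorph c hl.ne' '' C ⊆ D := by
      rintro _ ⟨y, hy, rfl⟩
      refine hD.mem_of_closedBall_subset (δ := ε * r) (by positivity) (fun z hz => ?_)
        (closedBall_homothety_subset hC.2.1 hε0 hlt hr hrC hy)
      rw [hεr, hausdorffDist_comm]
      exact hC.exists_norm_sub_le_hausdorffDist hD hz
    have hC' := hC.image_homothety c hl.ne'
    have h1 := hC'.intrinsicDiam_frontier_mono hD hsub hbD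
    have h2 := intrinsicDiam_frontier_homothety_le (hC'.intrinsicallyBounded_frontier hE) c
      (inv_pos.2 hl)
    rw [← homothetyHomeomorph_symm c hl.ne', ← image_comp, Homeomorph.symm_comp_self, image_id,
      le_inv_mul_iff₀ hl] at h2
    exact h2.trans h1
  · have hl : 0 < 1 + ε := by positivity
    have hsub := subset_image_homothety hC.2.1 hr hε0 hrC fun x hx => by
      rw [hεr]
      exact hD.exists_norm_sub_le_hausdorffDist hC hx
    exact (hD.intrinsicDiam_frontier_mono (hC.image_homothety c hl.ne') hsub
      (hbC.frontier_homothety c hl.ne')).trans (intrinsicDiam_frontier_homothety_le hbC c hl)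

theorem eq_of_path_in_frontier {m : ℕ} (hm : m ≤ 1) {C : Set (EuclideanSpace ℝ (Fin m))}
    (hC : IsClosed C) {γ : ℝ → EuclideanSpace ℝ (Fin m)} (hγ : ContinuousOn γ (Icc 0 1))
    (hmaps : MapsTo γ (Icc 0 1) (frontier C)) : γ 0 = γ 1 := by
  obtain rfl | rfl : m = 0 ∨ m = 1 := by omega
  · exact Subsingleton.elim _ _
  set φ : EuclideanSpace ℝ (Fin 1) → ℝ := fun x => x 0 with hφ
  have hφc : Continuous φ := by fun_prop
  have hinj : Function.Injective φ := fun x y h => by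
    ext i
    rw [Subsingleton.elim i 0]
    exact h
  by_contra hne
  have hsub : uIcc (φ (γ 0)) (φ (γ 1)) ⊆ (φ ∘ γ) '' Icc 0 1 := by
    have := intermediate_value_uIcc (f := φ ∘ γ) (a := 0) (b := 1)
      (by rw [uIcc_of_le zero_le_one]; exact hφc.comp_continuousOn hγ)
    rwa [uIcc_of_le (zero_le_one (α := ℝ))] at this
  obtain ⟨p, hp⟩ : (Ioo (min (φ (γ 0)) (φ (γ 1))) (max (φ (γ 0)) (φ (γ 1)))).Nonempty :=
    nonempty_Ioo.2 (min_lt_max.2 (hinj.ne hne))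
  have hopen : φ ⁻¹' Ioo (min (φ (γ 0)) (φ (γ 1))) (max (φ (γ 0)) (φ (γ 1))) ⊆ frontier C := by
    intro x hx
    obtain ⟨t, ht, hxt⟩ := hsub (Ioo_subset_Icc_self hx)
    rw [← hinj hxt]
    exact hmaps ht
  obtain ⟨t, _, rfl⟩ := hsub (Ioo_subset_Icc_self hp)
  have := interior_maximal hopen (isOpen_Ioo.preimage hφc) hp
  rwa [interior_frontier hC] at this

theorem intrinsicDiam_frontier_eq_zero {m : ℕ} (hm : m ≤ 1) {C : Set (EuclideanSpace ℝ (Fin m))}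
    (hC : IsClosed C) : intrinsicDiam (frontier C) = 0 := by
  refine le_antisymm (Real.sSup_le ?_ le_rfl) (intrinsicDiam_nonneg _)
  rintro _ ⟨x, hx, y, _, rfl⟩
  rw [intrinsicDist_eq_toReal]
  refine le_of_eq ((ENNReal.toReal_eq_zero_iff _).2 ?_)
  rcases eq_or_ne x y with rfl | hxy
  · left
    refine le_antisymm ((iInf_le _ ⟨fun _ => x, continuousOn_const, rfl, rfl, fun _ _ => hx⟩).trans
      (eVariationOn.constant_on ?_).le) zero_le
    exact (subsingleton_singleton (a := x)).anti (by rintro _ ⟨_, _, rfl⟩; rfl)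
  · right
    refine iInf_eq_top.2 ?_
    rintro ⟨γ, h1, h2, h3, h4⟩
    exact absurd (h2 ▸ h3 ▸ eq_of_path_in_frontier hm hC h1 h4) hxy

/-- Let `X` and `X_k` be convex surfaces in `ℝᵐ` with Hausdorff distance
of `X_k` to `X` tending to `0`. Then the intrinsic diameters of `X_k` converge to the
intrinsic diameter of `X`. -/
theorem intrinsicDiam_tendsto_of_hausdorff (m : ℕ)
    (X : Set (EuclideanSpace ℝ (Fin m))) (hX : IsConvexSurface X)
    (Xk : ℕ → Set (EuclideanSpace ℝ (Fin m))) (hXk : ∀ k, IsConvexSurface (Xk k))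
    (hH : Tendsto (fun k => Metric.hausdorffDist (Xk k) X) atTop (nhds 0)) :
    Tendsto (fun k => intrinsicDiam (Xk k)) atTop (nhds (intrinsicDiam X)) := by
  obtain ⟨C, hC, rfl⟩ := hX
  choose D hD hXD using hXk
  obtain rfl : Xk = fun k => frontier (D k) := funext hXD
  rcases le_or_gt m 1 with hm | hm
  · simp only [intrinsicDiam_frontier_eq_zero hm (hD _).1.isClosed,
      intrinsicDiam_frontier_eq_zero hm hC.1.isClosed, tendsto_const_nhds]
  have hE : 1 < Module.finrank ℝ (EuclideanSpace ℝ (Fin m)) := by simpa using hm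
  obtain ⟨c, hc⟩ := hC.2.2
  obtain ⟨r, hr, hrC⟩ := Metric.nhds_basis_closedBall.mem_iff.1 (mem_interior_iff_mem_nhds.1 hc)
  have hε : Tendsto (fun k => hausdorffDist (frontier (D k)) (frontier C) / r) atTop (nhds 0) := by
    simpa using hH.div_const r
  have hev : ∀ᶠ k in atTop, hausdorffDist (frontier (D k)) (frontier C) / r < 1 :=
    hε.eventually_lt_const one_pos
  refine tendsto_of_tendsto_of_tendsto_of_le_of_le'
    (g := fun k => (1 - hausdorffDist (frontier (D k)) (frontier C) / r) *
      intrinsicDiam (frontier C))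
    (h := fun k => (1 + hausdorffDist (frontier (D k)) (frontier C) / r) *
      intrinsicDiam (frontier C)) ?_ ?_ ?_ ?_
  · simpa using (hε.const_sub 1).mul_const (intrinsicDiam (frontier C))
  · simpa using (hε.const_add 1).mul_const (intrinsicDiam (frontier C))
  · exact hev.mono fun k hk => (hC.intrinsicDiam_frontier_bounds hE (hD k) hr hrC hk).1
  · exact hev.mono fun k hk => (hC.intrinsicDiam_frontier_bounds hE (hD k) hr hrC hk).2
end
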